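/- arXiv:hep-th/0205230 — 6 statements merged into one kernel-verified Lean document; each statement's English description precedes it below -/
import Mathlib

section
/- Let V be a real vector space of dimension 4r (r ≥ 1) equipped with a quaternionic triple J^1, J^2, J^3. Suppose a linear endomorphism M of V normalizes the hypercomplex structure, i.e. there exist real numbers m^1, m^2, m^3 such that J^α ∘ M − M ∘ J^α = 2 Σ_{β,γ} ε^{αβγ} m^γ J^β for each α ∈ {1,2,3}. Then necessarily m^α = (1/(4r)) · tr(J^α ∘ M) for each α, and the endomorphism N := M + Σ_α m^α J^α commutes with J^1, J^2 and J^3; in particular M decomposes as M = −Σ_α m^α J^α + N with [N, J^α] = 0. -/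
noncomputable section

/-- The Levi-Civita symbol on `Fin 3`, with `ε 0 1 2 = 1`. -/
def epsLC (a b c : Fin 3) : ℝ :=
  if (a, b, c) = ((0 : Fin 3), (1 : Fin 3), (2 : Fin 3)) ∨ (a, b, c) = (1, 2, 0) ∨ (a, b, c) = (2, 0, 1) then 1
  else if (a, b, c) = (2, 1, 0) ∨ (a, b, c) = (0, 2, 1) ∨ (a, b, c) = (1, 0, 2) then -1
  else 0

/-- A quaternionic triple on a real vector space: three endomorphisms satisfying the
quaternion algebra `J^α ∘ J^β = -δ^{αβ} id + Σ_γ ε^{αβγ} J^γ`. -/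
def QuatTriple {V : Type*} [AddCommGroup V] [Module ℝ V] (J : Fin 3 → V →ₗ[ℝ] V) : Prop :=
  ∀ α β, (J α) ∘ₗ (J β) =
    (if α = β then (-1 : ℝ) else 0) • (LinearMap.id : V →ₗ[ℝ] V) + ∑ γ, epsLC α β γ • J γ

/-- if an endomorphism `M` of a `4r`-dimensional quaternionic vector space
normalizes the hypercomplex structure, `J^α M - M J^α = 2 Σ ε^{αβγ} m^γ J^β`, then
`m^α = (1/(4r)) tr (J^α ∘ M)` and `N := M + Σ m^α J^α` commutes with each `J^α`. -/
theorem stmt_0 (r : ℕ) (hr : 1 ≤ r) (V : Type*) [AddCommGroup V] [Module ℝ V]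
    [FiniteDimensional ℝ V] (hdim : Module.finrank ℝ V = 4 * r)
    (J : Fin 3 → V →ₗ[ℝ] V) (hJ : QuatTriple J)
    (M : V →ₗ[ℝ] V) (m : Fin 3 → ℝ)
    (hM : ∀ α, (J α) ∘ₗ M - M ∘ₗ (J α) = ∑ β, ∑ γ, (2 * epsLC α β γ * m γ) • J β) :
    (∀ α, m α = (1 / (4 * (r : ℝ))) * LinearMap.trace ℝ V ((J α) ∘ₗ M)) ∧
    (∀ α, (M + ∑ α', m α' • J α') ∘ₗ (J α) = (J α) ∘ₗ (M + ∑ α', m α' • J α')) := by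
  have e : ∀ a b c, epsLC a b c =
      if (a, b, c) = ((0 : Fin 3), (1 : Fin 3), (2 : Fin 3)) ∨ (a, b, c) = (1, 2, 0) ∨
        (a, b, c) = (2, 0, 1) then 1
      else if (a, b, c) = (2, 1, 0) ∨ (a, b, c) = (0, 2, 1) ∨ (a, b, c) = (1, 0, 2) then -1
      else 0 := fun _ _ _ => rfl
  have hcomm : ∀ α, (M + ∑ α', m α' • J α') ∘ₗ (J α) =
      (J α) ∘ₗ (M + ∑ α', m α' • J α') := by
    intro α
    have h := hM α
    rw [sub_eq_iff_eq_add] at h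
    simp only [LinearMap.add_comp, LinearMap.comp_add, h, Fin.sum_univ_three,
      LinearMap.smul_comp, LinearMap.comp_smul, hJ _ _]
    fin_cases α <;> simp [e] <;> module
  refine ⟨?_, hcomm⟩
  generalize hN : M + ∑ α', m α' • J α' = N at hcomm
  have hMN : M = N - ∑ α', m α' • J α' := by rw [← hN]; abel
  -- a product of two anticommuting units has zero trace, also against `N`
  have key : ∀ (K : V →ₗ[ℝ] V), (∀ α, K ∘ₗ J α = J α ∘ₗ K) →
      ∀ α, LinearMap.trace ℝ V (J α ∘ₗ K) = 0 := by
    intro K hK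
    have aux : ∀ β γ, LinearMap.trace ℝ V ((J β ∘ₗ J γ) ∘ₗ K) =
        LinearMap.trace ℝ V ((J γ ∘ₗ J β) ∘ₗ K) := by
      intro β γ
      rw [LinearMap.comp_assoc, LinearMap.trace_comp_comm', LinearMap.comp_assoc, hK,
        LinearMap.comp_assoc]
    have h12 := aux 1 2
    have h20 := aux 2 0
    have h01 := aux 0 1
    simp only [hJ _ _, Fin.sum_univ_three] at h12 h20 h01
    simp [e, LinearMap.neg_comp] at h12 h20 h01
    intro α
    fin_cases α <;> simp <;> linarith
  have hid : LinearMap.trace ℝ V LinearMap.id = 4 * (r : ℝ) := by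
    rw [LinearMap.trace_id, hdim]; push_cast; rfl
  have ht : ∀ α, LinearMap.trace ℝ V (J α) = 0 := fun α => by
    simpa using key LinearMap.id (fun _ => rfl) α
  have hr' : (r : ℝ) ≠ 0 := by positivity
  intro α
  have h : LinearMap.trace ℝ V (J α ∘ₗ M) = m α * (4 * (r : ℝ)) := by
    rw [hMN, LinearMap.comp_sub, map_sub, key N hcomm α]
    simp only [Fin.sum_univ_three, LinearMap.comp_add, LinearMap.comp_smul, hJ _ _,
      map_add, map_smul, ht, hid]
    fin_cases α <;> simp
  rw [h]
  field_simp
end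
end

section
/- Let J^α (α = 1,2,3) be an almost hypercomplex structure on an open set U ⊆ ℝ^{4r} whose diagonal Nijenhuis tensor vanishes identically (a hypercomplex structure). Then the three complex structures are covariantly constant with respect to the Obata connection: ∂_X J^α_Y^Z − Γ^{Ob}_{XY}^W J^α_W^Z + Γ^{Ob}_{XW}^Z J^α_Y^W = 0 identically on U, for every α and all indices X, Y, Z. -/
noncomputable section

/-- Partial derivative `∂_i f` of a scalar function on `ℝ^n`. -/
def pd {n : ℕ} (i : Fin n) (f : (Fin n → ℝ) → ℝ) (x : Fin n → ℝ) : ℝ :=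
  fderiv ℝ f x (Pi.single i 1)

/-- The diagonal Nijenhuis tensor `N_{XY}^Z` of a triple of (1,1)-tensor fields. -/
def nijenhuis {n : ℕ} (J : Fin 3 → Fin n → Fin n → (Fin n → ℝ) → ℝ)
    (X Y Z : Fin n) (x : Fin n → ℝ) : ℝ :=
  (1 / 12) * ∑ α, ∑ W,
    (J α X W x * (pd W (J α Y Z) x - pd Y (J α W Z) x)
      - J α Y W x * (pd W (J α X Z) x - pd X (J α W Z) x))

/-- The Obata connection `Γ^{Ob}_{XY}^Z` of a triple of (1,1)-tensor fields. -/
def obata {n : ℕ} (J : Fin 3 → Fin n → Fin n → (Fin n → ℝ) → ℝ)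
    (X Y Z : Fin n) (x : Fin n → ℝ) : ℝ :=
  -(1 / 6) * ∑ α, ∑ W,
    ((pd X (J α Y W) x + pd Y (J α X W) x
        + (1 / 2) * ∑ β, ∑ γ, epsLC α β γ *
            ((∑ u, J β X u x * pd u (J γ Y W) x) + ∑ u, J β Y u x * pd u (J γ X W) x))
      * J α W Z x)

/-- An almost hypercomplex structure on an open set `U ⊆ ℝ^n`: a smooth family of three
(1,1)-tensor fields forming at every point of `U` a quaternionic triple. -/
def IsAlmostHypercomplexOn {n : ℕ} (J : Fin 3 → Fin n → Fin n → (Fin n → ℝ) → ℝ)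
    (U : Set (Fin n → ℝ)) : Prop :=
  (∀ α X Y, ContDiffOn ℝ (⊤ : ℕ∞) (J α X Y) U) ∧
  ∀ α β X Z, ∀ x ∈ U, ∑ W, J α X W x * J β W Z x =
    (if α = β then (-1 : ℝ) else 0) * (if X = Z then 1 else 0)
      + ∑ γ, epsLC α β γ * J γ X Z x

set_option linter.unusedSimpArgs false

/-- The algebraic core in terms of a connection `G` with `D = [G, J]`. -/
theorem core_G {V : Type*} [AddCommGroup V] [Module ℝ V]
    (i j k : V →ₗ[ℝ] V) (G : V →ₗ[ℝ] V →ₗ[ℝ] V) (Di Dj Dk Γ : V → V → V)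
    (hii : ∀ v, i (i v) = -v) (hjj : ∀ v, j (j v) = -v) (hkk : ∀ v, k (k v) = -v)
    (hij : ∀ v, j (i v) = k v) (hji : ∀ v, i (j v) = -k v)
    (hjk : ∀ v, k (j v) = i v) (hkj : ∀ v, j (k v) = -i v)
    (hki : ∀ v, i (k v) = j v) (hik : ∀ v, k (i v) = -j v)
    (hDi : ∀ u v, Di u v = i (G u v) - G u (i v))
    (hDj : ∀ u v, Dj u v = j (G u v) - G u (j v))
    (hDk : ∀ u v, Dk u v = k (G u v) - G u (k v))
    (hΓ : ∀ u v, Γ u v = -(1 / 6 : ℝ) •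
      (i (Di u v + Di v u + (1 / 2 : ℝ) •
          ((Dk (j u) v + Dk (j v) u) - (Dj (k u) v + Dj (k v) u)))
      + j (Dj u v + Dj v u + (1 / 2 : ℝ) •
          ((Di (k u) v + Di (k v) u) - (Dk (i u) v + Dk (i v) u)))
      + k (Dk u v + Dk v u + (1 / 2 : ℝ) •
          ((Dj (i u) v + Dj (i v) u) - (Di (j u) v + Di (j v) u)))))
    (hN : ∀ u v,
      (Di (i u) v - Di v (i u) - (Di (i v) u - Di u (i v)))
      + (Dj (j u) v - Dj v (j u) - (Dj (j v) u - Dj u (j v)))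
      + (Dk (k u) v - Dk v (k u) - (Dk (k v) u - Dk u (k v))) = 0) (u v : V) :
    Di u v - i (Γ u v) + Γ u (i v) = 0 := by
  have h1 := congrArg i (hN u v)
  have h2 := hN u (i v)
  simp only [hΓ, hDi, hDj, hDk, map_add, map_sub, map_neg, map_smul, map_zero,
    LinearMap.neg_apply, LinearMap.add_apply, hii, hjj, hkk, hij, hji, hjk, hkj, hki, hik]
    at h1 h2 ⊢
  linear_combination (norm := module) (1 / 12 : ℝ) • h1 - (1 / 12 : ℝ) • h2

/-- The algebraic core: only the differentiated quaternion relations are used. -/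
theorem core_D {V : Type*} [AddCommGroup V] [Module ℝ V]
    (i j k : V →ₗ[ℝ] V) (Di Dj Dk : V →ₗ[ℝ] V →ₗ[ℝ] V) (Γ : V → V → V)
    (hii : ∀ v, i (i v) = -v) (hjj : ∀ v, j (j v) = -v) (hkk : ∀ v, k (k v) = -v)
    (hij : ∀ v, j (i v) = k v) (hji : ∀ v, i (j v) = -k v)
    (hjk : ∀ v, k (j v) = i v) (hkj : ∀ v, j (k v) = -i v)
    (hki : ∀ v, i (k v) = j v) (hik : ∀ v, k (i v) = -j v)
    (dii : ∀ u v, i (Di u v) + Di u (i v) = 0)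
    (djj : ∀ u v, j (Dj u v) + Dj u (j v) = 0)
    (dkk : ∀ u v, k (Dk u v) + Dk u (k v) = 0)
    (dij : ∀ u v, j (Di u v) + Dj u (i v) = Dk u v)
    (dji : ∀ u v, i (Dj u v) + Di u (j v) = -Dk u v)
    (djk : ∀ u v, k (Dj u v) + Dk u (j v) = Di u v)
    (dkj : ∀ u v, j (Dk u v) + Dj u (k v) = -Di u v)
    (dki : ∀ u v, i (Dk u v) + Di u (k v) = Dj u v)
    (dik : ∀ u v, k (Di u v) + Dk u (i v) = -Dj u v)
    (hΓ : ∀ u v, Γ u v = -(1 / 6 : ℝ) •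
      (i (Di u v + Di v u + (1 / 2 : ℝ) •
          ((Dk (j u) v + Dk (j v) u) - (Dj (k u) v + Dj (k v) u)))
      + j (Dj u v + Dj v u + (1 / 2 : ℝ) •
          ((Di (k u) v + Di (k v) u) - (Dk (i u) v + Dk (i v) u)))
      + k (Dk u v + Dk v u + (1 / 2 : ℝ) •
          ((Dj (i u) v + Dj (i v) u) - (Di (j u) v + Di (j v) u)))))
    (hN : ∀ u v,
      (Di (i u) v - Di v (i u) - (Di (i v) u - Di u (i v)))
      + (Dj (j u) v - Dj v (j u) - (Dj (j v) u - Dj u (j v)))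
      + (Dk (k u) v - Dk v (k u) - (Dk (k v) u - Dk u (k v))) = 0) (u v : V) :
    Di u v - i (Γ u v) + Γ u (i v) = 0 ∧ Dj u v - j (Γ u v) + Γ u (j v) = 0
      ∧ Dk u v - k (Γ u v) + Γ u (k v) = 0 := by
  let G : V →ₗ[ℝ] V →ₗ[ℝ] V :=
    -(1 / 4 : ℝ) • (Di.compr₂ i + Dj.compr₂ j + Dk.compr₂ k)
  have hG : ∀ u v, G u v = -(1 / 4 : ℝ) • (i (Di u v) + j (Dj u v) + k (Dk u v)) := by
    intro u v; simp [G]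
  have hDi : ∀ u v, Di u v = i (G u v) - G u (i v) := by
    intro u v
    have e1 := eq_sub_of_add_eq' (dii u v)
    have e2 := eq_sub_of_add_eq' (dij u v)
    have e3 := eq_sub_of_add_eq' (dik u v)
    simp only [hG, map_add, map_sub, map_neg, map_smul, map_zero, e1, e2, e3,
      hii, hjj, hkk, hij, hji, hjk, hkj, hki, hik]
    module
  have hDj : ∀ u v, Dj u v = j (G u v) - G u (j v) := by
    intro u v
    have e1 := eq_sub_of_add_eq' (djj u v)
    have e2 := eq_sub_of_add_eq' (djk u v)
    have e3 := eq_sub_of_add_eq' (dji u v)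
    simp only [hG, map_add, map_sub, map_neg, map_smul, map_zero, e1, e2, e3,
      hii, hjj, hkk, hij, hji, hjk, hkj, hki, hik]
    module
  have hDk : ∀ u v, Dk u v = k (G u v) - G u (k v) := by
    intro u v
    have e1 := eq_sub_of_add_eq' (dkk u v)
    have e2 := eq_sub_of_add_eq' (dki u v)
    have e3 := eq_sub_of_add_eq' (dkj u v)
    simp only [hG, map_add, map_sub, map_neg, map_smul, map_zero, e1, e2, e3,
      hii, hjj, hkk, hij, hji, hjk, hkj, hki, hik]
    module
  clear_value G
  refine ⟨?_, ?_, ?_⟩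
  · exact core_G i j k G (fun u v => Di u v) (fun u v => Dj u v) (fun u v => Dk u v) Γ
      hii hjj hkk hij hji hjk hkj hki hik hDi hDj hDk hΓ hN u v
  · refine core_G j k i G (fun u v => Dj u v) (fun u v => Dk u v) (fun u v => Di u v) Γ
      hjj hkk hii hjk hkj hki hik hij hji hDj hDk hDi (fun u v => ?_) (fun u v => ?_) u v
    · rw [hΓ]; congr 1; abel
    · rw [← hN u v]; abel
  · refine core_G k i j G (fun u v => Dk u v) (fun u v => Di u v) (fun u v => Dj u v) Γ
      hkk hii hjj hki hik hij hji hjk hkj hDk hDi hDj (fun u v => ?_) (fun u v => ?_) u v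
    · rw [hΓ]; congr 1; abel
    · rw [← hN u v]; abel

/-- Row action of a matrix on vectors. -/
def rowAct {n : ℕ} (A : Fin n → Fin n → ℝ) : (Fin n → ℝ) →ₗ[ℝ] (Fin n → ℝ) :=
  Matrix.vecMulLinear (Matrix.of A)

theorem rowAct_apply {n : ℕ} (A : Fin n → Fin n → ℝ) (v : Fin n → ℝ) (Z : Fin n) :
    rowAct A v Z = ∑ W, v W * A W Z := by
  simp [rowAct, Matrix.vecMul, dotProduct]

/-- Bilinear map with given components. -/
def bil {n : ℕ} (B : Fin n → Fin n → Fin n → ℝ) :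
    (Fin n → ℝ) →ₗ[ℝ] (Fin n → ℝ) →ₗ[ℝ] (Fin n → ℝ) :=
  ∑ X, (LinearMap.proj X : (Fin n → ℝ) →ₗ[ℝ] ℝ).smulRight (rowAct (B X))

theorem bil_apply {n : ℕ} (B : Fin n → Fin n → Fin n → ℝ) (u v : Fin n → ℝ) (Z : Fin n) :
    bil B u v Z = ∑ X, u X * ∑ Y, v Y * B X Y Z := by
  simp [bil, rowAct_apply]

theorem rowAct_single {n : ℕ} (A : Fin n → Fin n → ℝ) (X : Fin n) :
    rowAct A (Pi.single X 1) = A X := by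
  ext Z; simp [rowAct_apply, Pi.single_apply]

theorem bil_single {n : ℕ} (B : Fin n → Fin n → Fin n → ℝ) (X Y : Fin n) :
    bil B (Pi.single X 1) (Pi.single Y 1) = B X Y := by
  ext Z; simp [bil_apply, Pi.single_apply]

theorem bil_single_left {n : ℕ} (B : Fin n → Fin n → Fin n → ℝ) (X : Fin n)
    (v : Fin n → ℝ) (Z : Fin n) :
    bil B (Pi.single X 1) v Z = ∑ Y, v Y * B X Y Z := by
  simp [bil_apply, Pi.single_apply]

theorem bil_single_right {n : ℕ} (B : Fin n → Fin n → Fin n → ℝ) (Y : Fin n)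
    (u : Fin n → ℝ) (Z : Fin n) :
    bil B u (Pi.single Y 1) Z = ∑ X, u X * B X Y Z := by
  simp [bil_apply, Pi.single_apply]

/-- Linear endomorphisms agreeing on the standard basis agree. -/
theorem lin_ext {n : ℕ} {f g : (Fin n → ℝ) →ₗ[ℝ] (Fin n → ℝ)}
    (h : ∀ X Z, f (Pi.single X 1) Z = g (Pi.single X 1) Z) (v : Fin n → ℝ) : f v = g v := by
  have : f = g := by
    refine LinearMap.pi_ext' fun X => LinearMap.ext_ring ?_
    ext Z; simpa using h X Z
  rw [this]

/-- Bilinear maps agreeing on the standard basis agree. -/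
theorem bil_ext {n : ℕ} {f g : (Fin n → ℝ) →ₗ[ℝ] (Fin n → ℝ) →ₗ[ℝ] (Fin n → ℝ)}
    (h : ∀ X Y Z, f (Pi.single X 1) (Pi.single Y 1) Z = g (Pi.single X 1) (Pi.single Y 1) Z)
    (u v : Fin n → ℝ) : f u v = g u v := by
  have : f = g := by
    refine LinearMap.pi_ext' fun X => LinearMap.ext_ring ?_
    refine LinearMap.ext fun v => ?_
    exact lin_ext (by simpa using h X) v
  rw [this]

/-- The differentiated quaternion relation. -/
theorem pd_quat {n : ℕ} (U : Set (Fin n → ℝ)) (hU : IsOpen U)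
    (J : Fin 3 → Fin n → Fin n → (Fin n → ℝ) → ℝ)
    (hJ : IsAlmostHypercomplexOn J U) (α β : Fin 3) (V X Z : Fin n)
    (x : Fin n → ℝ) (hx : x ∈ U) :
    (∑ W, pd V (J α X W) x * J β W Z x) + (∑ W, J α X W x * pd V (J β W Z) x)
      = ∑ γ, epsLC α β γ * pd V (J γ X Z) x := by
  have hd : ∀ α X Y, HasFDerivAt (J α X Y) (fderiv ℝ (J α X Y) x) x := fun α X Y =>
    (((hJ.1 α X Y).contDiffAt (hU.mem_nhds hx)).differentiableAt (by simp)).hasFDerivAt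
  have h1 := HasFDerivAt.fun_sum (u := Finset.univ)
    (fun (W : Fin n) _ => (hd α X W).mul (hd β W Z))
  have h2 := (HasFDerivAt.fun_sum (u := Finset.univ)
    (fun (γ : Fin 3) _ => (hd γ X Z).const_mul (epsLC α β γ))).const_add
      ((if α = β then (-1 : ℝ) else 0) * (if X = Z then 1 else 0))
  have h3 := h2.congr_of_eventuallyEq
    (Filter.eventuallyEq_of_mem (hU.mem_nhds hx) (fun y hy => hJ.2 α β X Z y hy))
  have h4 := congrArg (fun L => L (Pi.single V 1)) (h1.unique h3)
  simp only [ContinuousLinearMap.sum_apply, ContinuousLinearMap.add_apply,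
    ContinuousLinearMap.smul_apply, smul_eq_mul, Finset.sum_add_distrib] at h4
  simp only [pd]
  rw [← h4, add_comm]
  congr 1
  exact Finset.sum_congr rfl fun _ _ => mul_comm _ _

/-- an almost hypercomplex structure on an open `U ⊆ ℝ^{4r}` whose diagonal
Nijenhuis tensor vanishes identically has covariantly constant complex structures with
respect to its Obata connection. -/
theorem stmt_6 (r : ℕ) (U : Set (Fin (4 * r) → ℝ)) (hU : IsOpen U)
    (J : Fin 3 → Fin (4 * r) → Fin (4 * r) → (Fin (4 * r) → ℝ) → ℝ)
    (hJ : IsAlmostHypercomplexOn J U)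
    (hN : ∀ X Y Z, ∀ x ∈ U, nijenhuis J X Y Z x = 0) :
    ∀ α X Y Z, ∀ x ∈ U,
      pd X (J α Y Z) x
        - (∑ W, obata J X Y W x * J α W Z x)
        + (∑ W, obata J X W Z x * J α Y W x) = 0 := by
  intro α X Y Z x hx
  generalize 4 * r = n at *
  let A : Fin 3 → (Fin n → ℝ) →ₗ[ℝ] (Fin n → ℝ) := fun α => rowAct fun X Y => J α X Y x
  let D : Fin 3 → (Fin n → ℝ) →ₗ[ℝ] (Fin n → ℝ) →ₗ[ℝ] (Fin n → ℝ) :=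
    fun α => bil fun X Y Z => pd X (J α Y Z) x
  let Γ : (Fin n → ℝ) →ₗ[ℝ] (Fin n → ℝ) →ₗ[ℝ] (Fin n → ℝ) :=
    bil fun X Y Z => obata J X Y Z x
  have hA1 : ∀ α X, A α (Pi.single X 1) = fun Y => J α X Y x := fun α X => rowAct_single _ X
  have hA : ∀ α v Z, A α v Z = ∑ W, v W * J α W Z x := fun α v Z => rowAct_apply _ v Z
  have hD1 : ∀ α X Y, D α (Pi.single X 1) (Pi.single Y 1) = fun Z => pd X (J α Y Z) x :=
    fun α X Y => bil_single _ X Y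
  have hDl : ∀ α X v Z, D α (Pi.single X 1) v Z = ∑ Y, v Y * pd X (J α Y Z) x :=
    fun α X v Z => bil_single_left _ X v Z
  have hDr : ∀ α Y u Z, D α u (Pi.single Y 1) Z = ∑ X, u X * pd X (J α Y Z) x :=
    fun α X v Z => bil_single_right _ X v Z
  have hΓ1 : ∀ X Y, Γ (Pi.single X 1) (Pi.single Y 1) = fun Z => obata J X Y Z x :=
    fun X Y => bil_single _ X Y
  have hΓl : ∀ X v Z, Γ (Pi.single X 1) v Z = ∑ Y, v Y * obata J X Y Z x :=
    fun X v Z => bil_single_left _ X v Z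
  clear_value A D Γ
  -- quaternion relations
  have hq : ∀ α β v, A β (A α v) = (if α = β then (-1 : ℝ) else 0) • v
      + ∑ γ, epsLC α β γ • A γ v := by
    intro α β v
    have := lin_ext (f := A β ∘ₗ A α) (g := (if α = β then (-1 : ℝ) else 0) • LinearMap.id
      + ∑ γ, epsLC α β γ • A γ) (fun X Z => by
        have := hJ.2 α β X Z x hx
        simp only [LinearMap.comp_apply, hA1, hA, this, LinearMap.add_apply,
          LinearMap.smul_apply, LinearMap.id_apply, LinearMap.sum_apply, Pi.add_apply,
          Pi.smul_apply, Finset.sum_apply, smul_eq_mul, Pi.single_apply, eq_comm]) v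
    simpa only [LinearMap.comp_apply, LinearMap.add_apply, LinearMap.smul_apply,
      LinearMap.id_apply, LinearMap.sum_apply] using this
  have hdq : ∀ α β u v, A β (D α u v) + D β u (A α v) = ∑ γ, epsLC α β γ • D γ u v := by
    intro α β u v
    have := bil_ext (f := (D α).compr₂ (A β) + (D β).compl₂ (A α))
      (g := ∑ γ, epsLC α β γ • D γ) (fun V X Z => by
        have := pd_quat U hU J hJ α β V X Z x hx
        simp only [LinearMap.add_apply, LinearMap.compr₂_apply, LinearMap.compl₂_apply,
          LinearMap.sum_apply, LinearMap.smul_apply, Pi.add_apply, Pi.smul_apply,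
          Finset.sum_apply, smul_eq_mul, hA1, hD1, hA, hDl, this]) u v
    simpa using this
  have hNN : ∀ u v, ∑ α, (D α (A α u) v - D α v (A α u) - (D α (A α v) u - D α u (A α v))) = 0 := by
    intro u v
    have := bil_ext (f := ∑ α, ((D α).comp (A α) - (D α).flip.comp (A α)
        - ((D α).flip.compl₂ (A α) - (D α).compl₂ (A α)))) (g := 0) (fun X Y Z => by
        have := hN X Y Z x hx
        rw [nijenhuis, mul_eq_zero, or_iff_right (by norm_num)] at this
        simp only [LinearMap.add_apply, LinearMap.sub_apply, LinearMap.comp_apply,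
          LinearMap.flip_apply, LinearMap.compl₂_apply,
          LinearMap.sum_apply, Pi.sub_apply,
          Finset.sum_apply, hA1, hDl, hDr, LinearMap.zero_apply, Pi.zero_apply]
        rw [← this]
        refine Finset.sum_congr rfl fun α _ => ?_
        simp only [mul_sub, Finset.sum_sub_distrib]) u v
    simpa using this
  have hΓΓ : ∀ u v, Γ u v = -(1 / 6 : ℝ) • ∑ α, A α (D α u v + D α v u
      + (1 / 2 : ℝ) • ∑ β, ∑ γ, epsLC α β γ • (D γ (A β u) v + D γ (A β v) u)) := by
    intro u v
    have := bil_ext (f := Γ) (g := -(1 / 6 : ℝ) • ∑ α, (D α + (D α).flip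
      + (1 / 2 : ℝ) • ∑ β, ∑ γ, epsLC α β γ •
        ((D γ).comp (A β) + (D γ).flip.compl₂ (A β))).compr₂ (A α)) (fun X Y Z => by
        simp only [LinearMap.add_apply, LinearMap.comp_apply,
          LinearMap.flip_apply, LinearMap.compl₂_apply, LinearMap.compr₂_apply,
          LinearMap.sum_apply, LinearMap.smul_apply, Pi.add_apply, Pi.smul_apply,
          Finset.sum_apply, smul_eq_mul, hA1, hD1, hΓ1, hA, hDr, obata]) u v
    simpa using this
  have key := core_D (A 0) (A 1) (A 2) (D 0) (D 1) (D 2) (fun u v => Γ u v)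
    (by simpa [Fin.sum_univ_three, epsLC] using hq 0 0)
    (by simpa [Fin.sum_univ_three, epsLC] using hq 1 1)
    (by simpa [Fin.sum_univ_three, epsLC] using hq 2 2)
    (by simpa [Fin.sum_univ_three, epsLC] using hq 0 1)
    (by simpa [Fin.sum_univ_three, epsLC] using hq 1 0)
    (by simpa [Fin.sum_univ_three, epsLC] using hq 1 2)
    (by simpa [Fin.sum_univ_three, epsLC] using hq 2 1)
    (by simpa [Fin.sum_univ_three, epsLC] using hq 2 0)
    (by simpa [Fin.sum_univ_three, epsLC] using hq 0 2)
    (by simpa [Fin.sum_univ_three, epsLC] using hdq 0 0)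
    (by simpa [Fin.sum_univ_three, epsLC] using hdq 1 1)
    (by simpa [Fin.sum_univ_three, epsLC] using hdq 2 2)
    (by simpa [Fin.sum_univ_three, epsLC] using hdq 0 1)
    (by simpa [Fin.sum_univ_three, epsLC] using hdq 1 0)
    (by simpa [Fin.sum_univ_three, epsLC] using hdq 1 2)
    (by simpa [Fin.sum_univ_three, epsLC] using hdq 2 1)
    (by simpa [Fin.sum_univ_three, epsLC] using hdq 2 0)
    (by simpa [Fin.sum_univ_three, epsLC] using hdq 0 2)
    (by
      intro u v
      rw [hΓΓ]
      simp [Fin.sum_univ_three, epsLC]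
      module)
    (by
      intro u v
      rw [← hNN u v, Fin.sum_univ_three])
    (Pi.single X 1) (Pi.single Y 1)
  have fin : D α (Pi.single X 1) (Pi.single Y 1) - A α (Γ (Pi.single X 1) (Pi.single Y 1))
      + Γ (Pi.single X 1) (A α (Pi.single Y 1)) = 0 := by
    fin_cases α
    · exact key.1
    · exact key.2.1
    · exact key.2.2
  have := congrFun fin Z
  simp only [Pi.add_apply, Pi.sub_apply, hD1, hΓ1, hA1, hA, hΓl, Pi.zero_apply] at this
  rw [← this]
  congr 1
  exact Finset.sum_congr rfl fun _ _ => mul_comm _ _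
end
end

section
/- Let J^α (α = 1,2,3) be an almost hypercomplex structure on an open set U ⊆ ℝ^{4r} (r ≥ 1). Suppose smooth symmetric connection coefficients Γ_{XY}^Z and smooth SU(2)-connection functions ω_X^α on U satisfy the quaternionic covariant-constancy condition ∂_X J^α_Y^Z − Γ_{XY}^W J^α_W^Z + Γ_{XW}^Z J^α_Y^W + 2 ε^{αβγ} ω_X^β J^γ_Y^Z = 0. Define ω̃_X^α := (2/3) ω_X^α − (1/3) ε^{αβγ} J^β_X^Y ω_Y^γ. Then the diagonal Nijenhuis tensor of J satisfies N_{XY}^Z = −(1/2) Σ_α ( J^α_X^Z ω̃_Y^α − J^α_Y^Z ω̃_X^α ), and consequently ω̃ is determined by the Nijenhuis tensor: (1 − 2r) · ω̃_X^α = Σ_{Y,Z} N_{XY}^Z J^α_Z^Y. -/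
noncomputable section

/-- The modified SU(2) connection `ω̃_X^α = (2/3) ω_X^α − (1/3) ε^{αβγ} J^β_X^Y ω_Y^γ`. -/
def omegaTilde {n : ℕ} (J : Fin 3 → Fin n → Fin n → (Fin n → ℝ) → ℝ)
    (ω : Fin 3 → Fin n → (Fin n → ℝ) → ℝ) (α : Fin 3) (X : Fin n) (x : Fin n → ℝ) : ℝ :=
  (2 / 3) * ω α X x - (1 / 3) * ∑ β, ∑ γ, epsLC α β γ * ∑ Y, J β X Y x * ω γ Y x

theorem aux_gamma {n : ℕ} (J : Fin n → Fin n → ℝ) (G D P : Fin n → Fin n → Fin n → ℝ)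
    (hJ : ∀ X Z, ∑ W, J X W * J W Z = -(if X = Z then 1 else 0))
    (hG : ∀ X Y Z, G X Y Z = G Y X Z)
    (hD : ∀ X Y Z, D X Y Z - (∑ W, G X Y W * J W Z) + (∑ W, G X W Z * J Y W) + P X Y Z = 0)
    (X Y Z : Fin n) :
    ∑ W, J X W * (D W Y Z - D Y W Z) =
      -(∑ W, J X W * (P W Y Z - P Y W Z)) - (∑ W, ∑ V, J X W * J Y V * G W V Z) - G Y X Z := by
  have h1 : ∀ W, J X W * (D W Y Z - D Y W Z) =
      -(J X W * (P W Y Z - P Y W Z)) - (∑ V, J X W * J Y V * G W V Z)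
        + ∑ V, J X W * J W V * G Y V Z := by
    intro W
    have e1 := hD W Y Z
    have e2 := hD Y W Z
    have e3 : ∑ V, G Y W V * J V Z = ∑ V, G W Y V * J V Z :=
      Finset.sum_congr rfl fun V _ => by rw [hG Y W V]
    have e4 : (∑ V, J X W * J Y V * G W V Z) = J X W * ∑ V, G W V Z * J Y V := by
      rw [Finset.mul_sum]; exact Finset.sum_congr rfl fun V _ => by ring
    have e5 : (∑ V, J X W * J W V * G Y V Z) = J X W * ∑ V, G Y V Z * J W V := by
      rw [Finset.mul_sum]; exact Finset.sum_congr rfl fun V _ => by ring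
    rw [e4, e5]
    rw [e3] at e2
    linear_combination J X W * e1 - J X W * e2
  have h2 : ∑ W, ∑ V, J X W * J W V * G Y V Z = - G Y X Z := by
    rw [Finset.sum_comm]
    simp_rw [← Finset.sum_mul, hJ]
    simp
  simp_rw [h1]
  rw [Finset.sum_add_distrib, Finset.sum_sub_distrib, h2, Finset.sum_neg_distrib]
  ring

theorem aux_one {n : ℕ} (A B C : Fin n → Fin n → ℝ) (w v : Fin n → ℝ)
    (G D : Fin n → Fin n → Fin n → ℝ)
    (hJ : ∀ X Z, ∑ W, A X W * A W Z = -(if X = Z then 1 else 0))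
    (hAB : ∀ X Z, ∑ W, A X W * B W Z = - C X Z)
    (hAC : ∀ X Z, ∑ W, A X W * C W Z = B X Z)
    (hG : ∀ X Y Z, G X Y Z = G Y X Z)
    (hD : ∀ X Y Z, D X Y Z - (∑ W, G X Y W * A W Z) + (∑ W, G X W Z * A Y W)
      + 2 * (w X * B Y Z - v X * C Y Z) = 0)
    (X Y Z : Fin n) :
    ∑ W, (A X W * (D W Y Z - D Y W Z) - A Y W * (D W X Z - D X W Z)) =
      -2 * ((∑ W, A X W * w W) * B Y Z - (∑ W, A X W * v W) * C Y Z + w Y * C X Z + v Y * B X Z)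
      + 2 * ((∑ W, A Y W * w W) * B X Z - (∑ W, A Y W * v W) * C X Z
          + w X * C Y Z + v X * B Y Z) := by
  have key : ∀ X Y, ∑ W, A X W * (2 * (w W * B Y Z - v W * C Y Z)
        - 2 * (w Y * B W Z - v Y * C W Z)) =
      2 * ((∑ W, A X W * w W) * B Y Z - (∑ W, A X W * v W) * C Y Z + w Y * C X Z + v Y * B X Z) := by
    intro X Y
    have e1 := hAB X Z
    have e2 := hAC X Z
    have : ∀ W, A X W * (2 * (w W * B Y Z - v W * C Y Z) - 2 * (w Y * B W Z - v Y * C W Z)) =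
      2 * B Y Z * (A X W * w W) - 2 * C Y Z * (A X W * v W) - 2 * w Y * (A X W * B W Z)
        + 2 * v Y * (A X W * C W Z) := fun W => by ring
    simp_rw [this]
    rw [Finset.sum_add_distrib, Finset.sum_sub_distrib, Finset.sum_sub_distrib,
      ← Finset.mul_sum, ← Finset.mul_sum, ← Finset.mul_sum, ← Finset.mul_sum, e1, e2]
    ring
  have hs : ∑ W, ∑ V, A X W * A Y V * G W V Z = ∑ W, ∑ V, A Y W * A X V * G W V Z := by
    rw [Finset.sum_comm]
    refine Finset.sum_congr rfl fun W _ => Finset.sum_congr rfl fun V _ => ?_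
    rw [hG V W Z]; ring
  have g := aux_gamma A G D (fun X Y Z => 2 * (w X * B Y Z - v X * C Y Z)) hJ hG hD
  rw [Finset.sum_sub_distrib, g X Y Z, g Y X Z]
  simp only [key]
  rw [hs, hG Y X Z]
  ring

theorem aux_mv {n : ℕ} (A B C : Fin n → Fin n → ℝ)
    (h : ∀ X Z, ∑ W, A X W * B W Z = C X Z) (w : Fin n → ℝ) (X : Fin n) :
    ∑ W, A X W * (∑ V, B W V * w V) = ∑ V, C X V * w V := by
  simp_rw [← h, Finset.sum_mul, Finset.mul_sum]
  rw [Finset.sum_comm]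
  exact Finset.sum_congr rfl fun V _ => Finset.sum_congr rfl fun W _ => by ring

/-- if a symmetric connection `Γ` and SU(2)-connection `ω` make an almost
hypercomplex structure on `U ⊆ ℝ^{4r}` covariantly constant in the quaternionic sense,
then the diagonal Nijenhuis tensor is
`N_{XY}^Z = -(1/2) Σ_α (J^α_X^Z ω̃_Y^α − J^α_Y^Z ω̃_X^α)`, and
`(1 − 2r) ω̃_X^α = Σ_{Y,Z} N_{XY}^Z J^α_Z^Y`. -/
theorem stmt_8 (r : ℕ) (hr : 1 ≤ r) (U : Set (Fin (4 * r) → ℝ)) (hU : IsOpen U)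
    (J : Fin 3 → Fin (4 * r) → Fin (4 * r) → (Fin (4 * r) → ℝ) → ℝ)
    (hJ : IsAlmostHypercomplexOn J U)
    (Γ : Fin (4 * r) → Fin (4 * r) → Fin (4 * r) → (Fin (4 * r) → ℝ) → ℝ)
    (hΓsmooth : ∀ X Y Z, ContDiffOn ℝ (⊤ : ℕ∞) (Γ X Y Z) U)
    (hΓsym : ∀ X Y Z, ∀ x ∈ U, Γ X Y Z x = Γ Y X Z x)
    (ω : Fin 3 → Fin (4 * r) → (Fin (4 * r) → ℝ) → ℝ)
    (hωsmooth : ∀ α X, ContDiffOn ℝ (⊤ : ℕ∞) (ω α X) U)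
    (hcov : ∀ α X Y Z, ∀ x ∈ U,
      pd X (J α Y Z) x
        - (∑ W, Γ X Y W x * J α W Z x)
        + (∑ W, Γ X W Z x * J α Y W x)
        + 2 * ∑ β, ∑ γ, epsLC α β γ * ω β X x * J γ Y Z x = 0) :
    (∀ X Y Z, ∀ x ∈ U, nijenhuis J X Y Z x =
      -(1 / 2) * ∑ α, (J α X Z x * omegaTilde J ω α Y x - J α Y Z x * omegaTilde J ω α X x)) ∧
    (∀ α X, ∀ x ∈ U, (1 - 2 * (r : ℝ)) * omegaTilde J ω α X x
      = ∑ Y, ∑ Z, nijenhuis J X Y Z x * J α Z Y x) := by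
  have hN : ∀ X Y Z, ∀ x ∈ U, nijenhuis J X Y Z x =
      -(1 / 2) * ∑ α, (J α X Z x * omegaTilde J ω α Y x - J α Y Z x * omegaTilde J ω α X x) := by
    intro X Y Z x hx
    have q := fun α β X Z => hJ.2 α β X Z x hx
    have c := fun α X Y Z => hcov α X Y Z x hx
    have g := fun X Y Z => hΓsym X Y Z x hx
    have a0 := aux_one (fun X Y => J 0 X Y x) (fun X Y => J 2 X Y x) (fun X Y => J 1 X Y x)
      (fun X => ω 1 X x) (fun X => ω 2 X x) (fun X Y Z => Γ X Y Z x)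
      (fun X Y Z => pd X (J 0 Y Z) x)
      (fun X Z => by rw [q]; by_cases h : X = Z <;> simp [epsLC, h])
      (fun X Z => by rw [q]; simp [Fin.sum_univ_three, epsLC])
      (fun X Z => by rw [q]; simp [Fin.sum_univ_three, epsLC]) g
      (fun X Y Z => by rw [← c 0 X Y Z]; simp [Fin.sum_univ_three, epsLC]; ring) X Y Z
    have a1 := aux_one (fun X Y => J 1 X Y x) (fun X Y => J 0 X Y x) (fun X Y => J 2 X Y x)
      (fun X => ω 2 X x) (fun X => ω 0 X x) (fun X Y Z => Γ X Y Z x)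
      (fun X Y Z => pd X (J 1 Y Z) x)
      (fun X Z => by rw [q]; by_cases h : X = Z <;> simp [epsLC, h])
      (fun X Z => by rw [q]; simp [Fin.sum_univ_three, epsLC])
      (fun X Z => by rw [q]; simp [Fin.sum_univ_three, epsLC]) g
      (fun X Y Z => by rw [← c 1 X Y Z]; simp [Fin.sum_univ_three, epsLC]; ring) X Y Z
    have a2 := aux_one (fun X Y => J 2 X Y x) (fun X Y => J 1 X Y x) (fun X Y => J 0 X Y x)
      (fun X => ω 0 X x) (fun X => ω 1 X x) (fun X Y Z => Γ X Y Z x)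
      (fun X Y Z => pd X (J 2 Y Z) x)
      (fun X Z => by rw [q]; by_cases h : X = Z <;> simp [epsLC, h])
      (fun X Z => by rw [q]; simp [Fin.sum_univ_three, epsLC])
      (fun X Z => by rw [q]; simp [Fin.sum_univ_three, epsLC]) g
      (fun X Y Z => by rw [← c 2 X Y Z]; simp [Fin.sum_univ_three, epsLC]; ring) X Y Z
    unfold nijenhuis omegaTilde
    rw [Fin.sum_univ_three, a0, a1, a2]
    simp [Fin.sum_univ_three, epsLC]
    ring
  refine ⟨hN, ?_⟩
  intro α X x hx
  have q := fun α β X Z => hJ.2 α β X Z x hx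
  -- omegaTilde components
  have t : ∀ α X, omegaTilde J ω α X x =
      (2 / 3) * ω α X x - (1 / 3) * (∑ Y, J (α + 1) X Y x * ω (α + 2) Y x
        - ∑ Y, J (α + 2) X Y x * ω (α + 1) Y x) := by
    intro α X
    fin_cases α <;> simp [omegaTilde, Fin.sum_univ_three, epsLC] <;> ring
  -- products of the triple
  have sq : ∀ α X Z, ∑ W, J α X W x * J α W Z x = -(if X = Z then 1 else 0) := by
    intro α X Z
    rw [q]; by_cases h : X = Z <;> fin_cases α <;> simp [epsLC, h]
  have cp : ∀ α X Z, ∑ W, J (α + 1) X W x * J (α + 2) W Z x = J α X Z x := by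
    intro α X Z
    rw [q]; fin_cases α <;> simp [Fin.sum_univ_three, epsLC]
  have cm : ∀ α X Z, ∑ W, J (α + 2) X W x * J (α + 1) W Z x = - J α X Z x := by
    intro α X Z
    rw [q]; fin_cases α <;> simp [Fin.sum_univ_three, epsLC]
  have i3 : ∀ α : Fin 3, α + 1 + 1 = α + 2 ∧ α + 1 + 2 = α ∧ α + 2 + 1 = α ∧ α + 2 + 2 = α + 1 := by
    decide
  obtain ⟨i1, i2, i4, i5⟩ := i3 α
  have cp1 := cp (α + 1)
  have cm1 := cm (α + 1)
  have cp2 := cp (α + 2)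
  have cm2 := cm (α + 2)
  rw [i1, i2] at cp1 cm1
  rw [i4, i5] at cp2 cm2
  -- traces
  have swap : ∀ β γ, ∑ Y, ∑ Z, J β Y Z x * J γ Z Y x = ∑ Y, ∑ Z, J γ Y Z x * J β Z Y x := by
    intro β γ
    rw [Finset.sum_comm]
    exact Finset.sum_congr rfl fun _ _ => Finset.sum_congr rfl fun _ _ => by ring
  have tr1 : ∑ Y, ∑ Z, J (α + 1) Y Z x * J α Z Y x = 0 := by
    have := swap (α + 1) α
    simp only [cp2, cm2, Finset.sum_neg_distrib] at this ⊢
    linarith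
  have tr2 : ∑ Y, ∑ Z, J (α + 2) Y Z x * J α Z Y x = 0 := by
    have := swap (α + 2) α
    simp only [cp1, cm1, Finset.sum_neg_distrib] at this ⊢
    linarith
  have tr0 : ∑ Y, ∑ Z, J α Y Z x * J α Z Y x = -(4 * r) := by
    simp only [sq]
    simp
  have s3 : ∀ f : Fin 3 → ℝ, ∑ β, f β = f α + f (α + 1) + f (α + 2) := by
    intro f
    rw [Fin.sum_univ_three]
    fin_cases α <;> simp <;> ring
  -- contraction
  have contr : ∑ Y, ∑ Z, nijenhuis J X Y Z x * J α Z Y x =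
      -(1 / 2) * (-omegaTilde J ω α X x - ∑ Y, J (α + 2) X Y x * omegaTilde J ω (α + 1) Y x
        + ∑ Y, J (α + 1) X Y x * omegaTilde J ω (α + 2) Y x
        + 4 * r * omegaTilde J ω α X x) := by
    have one : ∀ (β : Fin 3) (K : Fin (4 * r) → ℝ) (τ : ℝ),
        (∀ Y, ∑ Z, J β X Z x * J α Z Y x = K Y) →
        (∑ Y, ∑ Z, J β Y Z x * J α Z Y x = τ) →
        ∑ Y, ∑ Z, (J β X Z x * omegaTilde J ω β Y x - J β Y Z x * omegaTilde J ω β X x)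
          * J α Z Y x
        = ∑ Y, K Y * omegaTilde J ω β Y x - τ * omegaTilde J ω β X x := by
      intro β K τ hK hτ
      rw [← hτ, Finset.sum_mul, ← Finset.sum_sub_distrib]
      refine Finset.sum_congr rfl fun Y _ => ?_
      rw [← hK, Finset.sum_mul, Finset.sum_mul, ← Finset.sum_sub_distrib]
      exact Finset.sum_congr rfl fun Z _ => by ring
    have o0 := one α _ _ (sq α X) tr0
    have o1 := one (α + 1) _ _ (cm2 X) tr1
    have o2 := one (α + 2) _ _ (cp1 X) tr2
    have split : ∑ Y, ∑ Z, nijenhuis J X Y Z x * J α Z Y x = -(1 / 2) * (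
        (∑ Y, ∑ Z, (J α X Z x * omegaTilde J ω α Y x - J α Y Z x * omegaTilde J ω α X x)
          * J α Z Y x)
        + (∑ Y, ∑ Z, (J (α + 1) X Z x * omegaTilde J ω (α + 1) Y x
            - J (α + 1) Y Z x * omegaTilde J ω (α + 1) X x) * J α Z Y x)
        + (∑ Y, ∑ Z, (J (α + 2) X Z x * omegaTilde J ω (α + 2) Y x
            - J (α + 2) Y Z x * omegaTilde J ω (α + 2) X x) * J α Z Y x)) := by
      simp only [← Finset.sum_add_distrib, Finset.mul_sum]
      refine Finset.sum_congr rfl fun Y _ => Finset.sum_congr rfl fun Z _ => ?_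
      rw [hN X Y Z x hx, s3]
      ring
    rw [split, o0, o1, o2]
    simp only [neg_mul, Finset.sum_neg_distrib, ite_mul, one_mul, zero_mul,
      Finset.sum_ite_eq, Finset.mem_univ, if_true]
    ring
  have eig : ∑ Y, J (α + 1) X Y x * omegaTilde J ω (α + 2) Y x
      - ∑ Y, J (α + 2) X Y x * omegaTilde J ω (α + 1) Y x = - omegaTilde J ω α X x := by
    have u1 := t (α + 1)
    have u2 := t (α + 2)
    rw [i1, i2] at u1
    rw [i4, i5] at u2
    have lin : ∀ (A : Fin (4 * r) → ℝ) (f g h : Fin (4 * r) → ℝ),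
        ∑ Y, A Y * ((2 / 3) * f Y - (1 / 3) * (g Y - h Y)) =
        (2 / 3) * ∑ Y, A Y * f Y - (1 / 3) * (∑ Y, A Y * g Y - ∑ Y, A Y * h Y) := by
      intro A f g h
      rw [← Finset.sum_sub_distrib, Finset.mul_sum, Finset.mul_sum, ← Finset.sum_sub_distrib]
      exact Finset.sum_congr rfl fun Y _ => by ring
    have m1 := aux_mv (fun X Y => J (α + 1) X Y x) (fun X Y => J α X Y x) _ cm2
      (fun Y => ω (α + 1) Y x) X
    have m2 := aux_mv (fun X Y => J (α + 1) X Y x) (fun X Y => J (α + 1) X Y x) _ (sq (α + 1))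
      (fun Y => ω α Y x) X
    have m3 := aux_mv (fun X Y => J (α + 2) X Y x) (fun X Y => J α X Y x) _ cp1
      (fun Y => ω (α + 2) Y x) X
    have m4 := aux_mv (fun X Y => J (α + 2) X Y x) (fun X Y => J (α + 2) X Y x) _ (sq (α + 2))
      (fun Y => ω α Y x) X
    simp only [neg_mul, Finset.sum_neg_distrib, ite_mul, one_mul, zero_mul,
      Finset.sum_ite_eq, Finset.mem_univ, if_true] at m1 m2 m3 m4
    simp only [u1, u2, t α X]
    rw [lin, lin, m1, m2, m3, m4]
    ring
  rw [contr]
  linear_combination (1 / 2 : ℝ) * eig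
end
end

section
/- Let J^α (α = 1,2,3) be an almost hypercomplex structure on an open set U ⊆ ℝ^{4r}, and suppose there exist smooth functions ω_X^α on U such that the diagonal Nijenhuis tensor satisfies N_{XY}^Z = −(1/2) Σ_α ( J^α_X^Z ω_Y^α − J^α_Y^Z ω_X^α ). Define the Oproiu connection Γ^{Op}_{XY}^Z := Γ^{Ob}_{XY}^Z − (1/2) Σ_α ( J^α_X^Z ω_Y^α + J^α_Y^Z ω_X^α ), where Γ^{Ob} is the Obata connection. Then Γ^{Op} is symmetric in X, Y, and the pair (Γ^{Op}, ω) makes the complex structures covariantly constant in the quaternionic sense: ∂_X J^α_Y^Z − Γ^{Op}_{XY}^W J^α_W^Z + Γ^{Op}_{XW}^Z J^α_Y^W + 2 ε^{αβγ} ω_X^β J^γ_Y^Z = 0 identically on U. -/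
noncomputable section

/-- The Oproiu connection
`Γ^{Op}_{XY}^Z = Γ^{Ob}_{XY}^Z − (1/2) Σ_α (J^α_X^Z ω_Y^α + J^α_Y^Z ω_X^α)`. -/
def oproiu {n : ℕ} (J : Fin 3 → Fin n → Fin n → (Fin n → ℝ) → ℝ)
    (ω : Fin 3 → Fin n → (Fin n → ℝ) → ℝ) (X Y Z : Fin n) (x : Fin n → ℝ) : ℝ :=
  obata J X Y Z x - (1 / 2) * ∑ α, (J α X Z x * ω α Y x + J α Y Z x * ω α X x)

/-- Quaternion relations in an algebra. -/
def QuatRel {A : Type*} [Ring A] (j : Fin 3 → A) : Prop :=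
  (j 0 * j 0 = -1 ∧ j 1 * j 1 = -1 ∧ j 2 * j 2 = -1) ∧
  (j 0 * j 1 = j 2 ∧ j 1 * j 2 = j 0 ∧ j 2 * j 0 = j 1) ∧
  (j 1 * j 0 = -j 2 ∧ j 2 * j 1 = -j 0 ∧ j 0 * j 2 = -j 1)

/-- Linearized quaternion relations. -/
def DQuatRel {A : Type*} [Ring A] (j d : Fin 3 → A) : Prop :=
  (j 0 * d 0 = -(d 0 * j 0) ∧ j 1 * d 1 = -(d 1 * j 1) ∧ j 2 * d 2 = -(d 2 * j 2)) ∧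
  (j 0 * d 1 = d 2 - d 0 * j 1 ∧ j 1 * d 2 = d 0 - d 1 * j 2 ∧ j 2 * d 0 = d 1 - d 2 * j 0) ∧
  (j 1 * d 0 = -d 2 - d 1 * j 0 ∧ j 2 * d 1 = -d 0 - d 2 * j 1 ∧ j 0 * d 2 = -d 1 - d 0 * j 2)

lemma assoc_aux {A : Type*} [Ring A] {a b c : A} (h : a * b = c) (x : A) :
    a * (b * x) = c * x := by rw [← mul_assoc, h]

/-- The part of the connection that reproduces the derivative. -/
lemma main_part {A : Type*} [Ring A] (j d : Fin 3 → A) (hj : QuatRel j) (hd : DQuatRel j d)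
    (α : Fin 3) :
    (d 0 * j 0 + d 1 * j 1 + d 2 * j 2) * j α - j α * (d 0 * j 0 + d 1 * j 1 + d 2 * j 2)
      = -(4 * d α) := by
  obtain ⟨⟨h1, h2, h3⟩, ⟨h4, h5, h6⟩, h7, h8, h9⟩ := hj
  obtain ⟨⟨k1, k2, k3⟩, ⟨k4, k5, k6⟩, k7, k8, k9⟩ := hd
  have e : (4 * d α) = d α + d α + d α + d α := by noncomm_ring
  rw [e]
  fin_cases α <;>
  simp [mul_add, add_mul, mul_sub, sub_mul, mul_assoc, h1, h2, h3, h4, h5, h6, h7, h8, h9,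
    assoc_aux k1, assoc_aux k2, assoc_aux k3, assoc_aux k4, assoc_aux k5, assoc_aux k6,
    assoc_aux k7, assoc_aux k8, assoc_aux k9] <;> abel

lemma comm_part {A : Type*} [Ring A] (j d : Fin 3 → A) (hj : QuatRel j) (hd : DQuatRel j d)
    (α : Fin 3) :
    (Commute (d 1 * j 2 - d 2 * j 1 - d 0) (j α)) ∧
    (Commute (d 2 * j 0 - d 0 * j 2 - d 1) (j α)) ∧
    (Commute (d 0 * j 1 - d 1 * j 0 - d 2) (j α)) := by
  obtain ⟨⟨h1, h2, h3⟩, ⟨h4, h5, h6⟩, h7, h8, h9⟩ := hj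
  obtain ⟨⟨k1, k2, k3⟩, ⟨k4, k5, k6⟩, k7, k8, k9⟩ := hd
  unfold Commute SemiconjBy
  refine ⟨?_, ?_, ?_⟩ <;> fin_cases α <;>
  simp [mul_add, add_mul, mul_sub, sub_mul, mul_assoc, h1, h2, h3, h4, h5, h6, h7, h8, h9,
    k1, k2, k3, k4, k5, k6, k7, k8, k9,
    assoc_aux k1, assoc_aux k2, assoc_aux k3, assoc_aux k4, assoc_aux k5, assoc_aux k6,
    assoc_aux k7, assoc_aux k8, assoc_aux k9] <;> abel

lemma b_part {A : Type*} [Ring A] (j b : Fin 3 → A) (hj : QuatRel j) (α : Fin 3) :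
    Commute (b 0 * j 0 + b 1 * j 1 + b 2 * j 2
      + (j 0 * b 1 * j 2 - j 0 * b 2 * j 1 + j 1 * b 2 * j 0 - j 1 * b 0 * j 2
        + j 2 * b 0 * j 1 - j 2 * b 1 * j 0)
      + (j 0 * b 0 + j 1 * b 1 + j 2 * b 2)) (j α) := by
  obtain ⟨⟨h1, h2, h3⟩, ⟨h4, h5, h6⟩, h7, h8, h9⟩ := hj
  unfold Commute SemiconjBy
  fin_cases α <;>
  simp [mul_add, add_mul, mul_sub, sub_mul, mul_assoc, h1, h2, h3, h4, h5, h6, h7, h8, h9,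
    assoc_aux h1, assoc_aux h2, assoc_aux h3, assoc_aux h4, assoc_aux h5, assoc_aux h6,
    assoc_aux h7, assoc_aux h8, assoc_aux h9] <;> abel

/-- The torsionful Obata connection preserves the hypercomplex structure. -/
lemma alg_main {A : Type*} [Ring A] [Algebra ℝ A] (j d b : Fin 3 → A) (e : Fin 3 → Fin 3 → A)
    (hj : QuatRel j) (hd : DQuatRel j d) (he : ∀ β, DQuatRel j (e β)) (w : Fin 3 → ℝ)
    (G : A)
    (hG : G = (-(1 / 6) : ℝ) • ∑ α, (d α + b α + (1 / 2 : ℝ) • ∑ β, ∑ γ, epsLC α β γ •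
        (e β γ + j β * b γ)) * j α
      + (1 / 12 : ℝ) • ∑ α, (e α α + b α * j α - j α * b α + j α * d α)
      - ∑ α, w α • j α) (α : Fin 3) :
    d α - G * j α + j α * G + (2 : ℝ) • ∑ β, ∑ γ, (epsLC α β γ * w β) • j γ = 0 := by
  set P := d 0 * j 0 + d 1 * j 1 + d 2 * j 2 with hP
  set Q0 := e 0 1 * j 2 - e 0 2 * j 1 - e 0 0 with hQ0
  set Q1 := e 1 2 * j 0 - e 1 0 * j 2 - e 1 1 with hQ1
  set Q2 := e 2 0 * j 1 - e 2 1 * j 0 - e 2 2 with hQ2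
  set M := b 0 * j 0 + b 1 * j 1 + b 2 * j 2
      + (j 0 * b 1 * j 2 - j 0 * b 2 * j 1 + j 1 * b 2 * j 0 - j 1 * b 0 * j 2
        + j 2 * b 0 * j 1 - j 2 * b 1 * j 0)
      + (j 0 * b 0 + j 1 * b 1 + j 2 * b 2) with hM
  have hG' : G = (-(1 / 4) : ℝ) • P - (1 / 12 : ℝ) • (Q0 + Q1 + Q2 + M) -
      (w 0 • j 0 + w 1 • j 1 + w 2 • j 2) := by
    rw [hG, hP, hQ0, hQ1, hQ2, hM]
    obtain ⟨⟨k1, k2, k3⟩, -⟩ := hd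
    simp only [Fin.sum_univ_three, k1, k2, k3]
    simp [epsLC, add_mul, sub_mul]
    module
  have c1 := main_part j d hj hd α
  have c2 := (comm_part j (e 0) hj (he 0) α).1
  have c3 := (comm_part j (e 1) hj (he 1) α).2.1
  have c4 := (comm_part j (e 2) hj (he 2) α).2.2
  have c5 := b_part j b hj α
  rw [← hP] at c1
  rw [← hQ0] at c2
  rw [← hQ1] at c3
  rw [← hQ2] at c4
  rw [← hM] at c5
  have c := ((c2.add_left c3).add_left c4).add_left c5
  have c' := c.eq
  have c1' : P * j α = j α * P - (4 : ℝ) • d α := by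
    have : (4 : A) * d α = (4 : ℝ) • d α := by
      rw [show (4 : A) = algebraMap ℝ A 4 from (map_ofNat _ 4).symm, ← Algebra.smul_def]
    rw [← this, sub_eq_add_neg, ← c1]; abel
  rw [hG', sub_mul, sub_mul, mul_sub, mul_sub, smul_mul_assoc, smul_mul_assoc, mul_smul_comm,
    mul_smul_comm, c', c1']
  obtain ⟨⟨h1, h2, h3⟩, ⟨h4, h5, h6⟩, h7, h8, h9⟩ := hj
  clear_value P Q0 Q1 Q2 M
  fin_cases α <;>
  simp [Fin.sum_univ_three, epsLC, mul_add, add_mul, h1, h2, h3, h4, h5, h6, h7, h8, h9] <;>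
  module

lemma pd_rel {n : ℕ} (U : Set (Fin n → ℝ)) (hU : IsOpen U)
    (J : Fin 3 → Fin n → Fin n → (Fin n → ℝ) → ℝ) (hJ : IsAlmostHypercomplexOn J U)
    (x : Fin n → ℝ) (hx : x ∈ U) (α β : Fin 3) (V X Z : Fin n) :
    ∑ W, (pd V (J α X W) x * J β W Z x + J α X W x * pd V (J β W Z) x)
      = ∑ γ, epsLC α β γ * pd V (J γ X Z) x := by
  obtain ⟨hs, hq⟩ := hJ
  have hdiff : ∀ α X Y, DifferentiableAt ℝ (J α X Y) x := fun α X Y =>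
    ((hs α X Y).contDiffAt (hU.mem_nhds hx)).differentiableAt (by simp)
  have hev : (fun y => ∑ W, J α X W y * J β W Z y) =ᶠ[nhds x] (fun y =>
      (if α = β then (-1 : ℝ) else 0) * (if X = Z then 1 else 0)
      + ∑ γ, epsLC α β γ * J γ X Z y) := by
    filter_upwards [hU.mem_nhds hx] with y hy using hq α β X Z y hy
  have h := hev.fderiv_eq (𝕜 := ℝ)
  have h1 : HasFDerivAt (fun y => ∑ W, J α X W y * J β W Z y)
      (∑ W, (J α X W x • fderiv ℝ (J β W Z) x + J β W Z x • fderiv ℝ (J α X W) x)) x :=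
    HasFDerivAt.fun_sum fun W _ => (hdiff α X W).hasFDerivAt.mul (hdiff β W Z).hasFDerivAt
  have h2 : HasFDerivAt (fun y => (if α = β then (-1 : ℝ) else 0) * (if X = Z then 1 else 0)
      + ∑ γ, epsLC α β γ * J γ X Z y) (∑ γ, epsLC α β γ • fderiv ℝ (J γ X Z) x) x :=
    (HasFDerivAt.fun_sum fun γ _ => (hdiff γ X Z).hasFDerivAt.const_mul _).const_add _
  rw [h1.fderiv, h2.fderiv] at h
  have h' := congrArg (fun L => L (Pi.single V (1 : ℝ))) h
  simp only [sum_apply, ContinuousLinearMap.add_apply, ContinuousLinearMap.smul_apply,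
    ContinuousLinearMap.sum_apply, smul_eq_mul] at h'
  unfold pd
  rw [← h']
  exact Finset.sum_congr rfl fun W _ => by ring

lemma DQuatRel_of {A : Type*} [Ring A] [Algebra ℝ A] (j d : Fin 3 → A)
    (h : ∀ α β, d α * j β + j α * d β = ∑ γ, epsLC α β γ • d γ) : DQuatRel j d := by
  refine ⟨⟨?_, ?_, ?_⟩, ⟨?_, ?_, ?_⟩, ?_, ?_, ?_⟩
  · have := h 0 0; simp [Fin.sum_univ_three, epsLC] at this; exact eq_neg_of_add_eq_zero_right this
  · have := h 1 1; simp [Fin.sum_univ_three, epsLC] at this; exact eq_neg_of_add_eq_zero_right this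
  · have := h 2 2; simp [Fin.sum_univ_three, epsLC] at this; exact eq_neg_of_add_eq_zero_right this
  · have := h 0 1; simp [Fin.sum_univ_three, epsLC] at this; exact eq_sub_of_add_eq' this
  · have := h 1 2; simp [Fin.sum_univ_three, epsLC] at this; exact eq_sub_of_add_eq' this
  · have := h 2 0; simp [Fin.sum_univ_three, epsLC] at this; exact eq_sub_of_add_eq' this
  · have := h 1 0; simp [Fin.sum_univ_three, epsLC] at this; exact eq_sub_of_add_eq' this
  · have := h 2 1; simp [Fin.sum_univ_three, epsLC] at this; exact eq_sub_of_add_eq' this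
  · have := h 0 2; simp [Fin.sum_univ_three, epsLC] at this; exact eq_sub_of_add_eq' this

lemma QuatRel_of {A : Type*} [Ring A] [Algebra ℝ A] (j : Fin 3 → A)
    (h : ∀ α β, j α * j β = (if α = β then (-1 : ℝ) else 0) • (1 : A) +
      ∑ γ, epsLC α β γ • j γ) : QuatRel j := by
  refine ⟨⟨?_, ?_, ?_⟩, ⟨?_, ?_, ?_⟩, ?_, ?_, ?_⟩ <;> rw [h] <;>
    simp [Fin.sum_univ_three, epsLC]

/-- if the diagonal Nijenhuis tensor of an almost hypercomplex structure on
`U ⊆ ℝ^{4r}` satisfies `N_{XY}^Z = -(1/2) Σ_α (J^α_X^Z ω_Y^α − J^α_Y^Z ω_X^α)` for smooth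
functions `ω`, then the Oproiu connection is symmetric and, together with `ω`, makes the
complex structures covariantly constant in the quaternionic sense. -/
theorem stmt_10 (r : ℕ) (U : Set (Fin (4 * r) → ℝ)) (hU : IsOpen U)
    (J : Fin 3 → Fin (4 * r) → Fin (4 * r) → (Fin (4 * r) → ℝ) → ℝ)
    (hJ : IsAlmostHypercomplexOn J U)
    (ω : Fin 3 → Fin (4 * r) → (Fin (4 * r) → ℝ) → ℝ)
    (hωsmooth : ∀ α X, ContDiffOn ℝ (⊤ : ℕ∞) (ω α X) U)
    (hN : ∀ X Y Z, ∀ x ∈ U, nijenhuis J X Y Z x =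
      -(1 / 2) * ∑ α, (J α X Z x * ω α Y x - J α Y Z x * ω α X x)) :
    (∀ X Y Z, ∀ x ∈ U, oproiu J ω X Y Z x = oproiu J ω Y X Z x) ∧
    (∀ α X Y Z, ∀ x ∈ U,
      pd X (J α Y Z) x
        - (∑ W, oproiu J ω X Y W x * J α W Z x)
        + (∑ W, oproiu J ω X W Z x * J α Y W x)
        + 2 * ∑ β, ∑ γ, epsLC α β γ * ω β X x * J γ Y Z x = 0) := by
  refine ⟨?_, ?_⟩
  · intro X Y Z x _
    unfold oproiu obata
    congr 1
    · congr 1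
      refine Finset.sum_congr rfl fun α _ => Finset.sum_congr rfl fun W _ => ?_
      congr 1
      congr 1
      · ring
      · congr 1
        refine Finset.sum_congr rfl fun β _ => Finset.sum_congr rfl fun γ _ => ?_
        ring
    · congr 1
      exact Finset.sum_congr rfl fun α _ => by ring
  intro α X Y Z x hx
  let j : Fin 3 → Matrix (Fin (4 * r)) (Fin (4 * r)) ℝ := fun a => Matrix.of fun y z => J a y z x
  let D : Fin (4 * r) → Fin 3 → Matrix (Fin (4 * r)) (Fin (4 * r)) ℝ :=
    fun V a => Matrix.of fun y z => pd V (J a y z) x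
  let b : Fin 3 → Matrix (Fin (4 * r)) (Fin (4 * r)) ℝ :=
    fun a => Matrix.of fun y z => pd y (J a X z) x
  let e : Fin 3 → Fin 3 → Matrix (Fin (4 * r)) (Fin (4 * r)) ℝ :=
    fun β γ => ∑ u, J β X u x • D u γ
  let G : Matrix (Fin (4 * r)) (Fin (4 * r)) ℝ := Matrix.of fun y z => oproiu J ω X y z x
  have hj : QuatRel j := by
    apply QuatRel_of
    intro a c
    ext y z
    have := hJ.2 a c y z x hx
    simp only [j, Matrix.mul_apply, Matrix.of_apply, Matrix.add_apply, Matrix.smul_apply,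
      Matrix.sum_apply, Matrix.one_apply, smul_eq_mul]
    exact this
  have hrel : ∀ V a c, D V a * j c + j a * D V c = ∑ γ, epsLC a c γ • D V γ := by
    intro V a c
    ext y z
    have := pd_rel U hU J hJ x hx a c V y z
    rw [Finset.sum_add_distrib] at this
    simp only [j, D, Matrix.mul_apply, Matrix.of_apply, Matrix.add_apply, Matrix.smul_apply,
      Matrix.sum_apply, smul_eq_mul]
    exact this
  have hD : ∀ V, DQuatRel j (D V) := fun V => DQuatRel_of j (D V) (hrel V)
  have he : ∀ β, DQuatRel j (e β) := by
    intro β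
    apply DQuatRel_of
    intro a c
    simp only [e, Finset.sum_mul, Finset.mul_sum, smul_mul_assoc, mul_smul_comm]
    rw [← Finset.sum_add_distrib]
    simp only [← smul_add, hrel, Finset.smul_sum]
    rw [Finset.sum_comm]
    exact Finset.sum_congr rfl fun _ _ => Finset.sum_congr rfl fun _ _ => smul_comm _ _ _
  have hG : G = (-(1 / 6) : ℝ) • ∑ α, (D X α + b α + (1 / 2 : ℝ) • ∑ β, ∑ γ, epsLC α β γ •
        (e β γ + j β * b γ)) * j α
      + (1 / 12 : ℝ) • ∑ α, (e α α + b α * j α - j α * b α + j α * D X α)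
      - ∑ α, ω α X x • j α := by
    ext y z
    have hob : obata J X y z x = ((-(1 / 6) : ℝ) • ∑ α, (D X α + b α + (1 / 2 : ℝ) •
        ∑ β, ∑ γ, epsLC α β γ • (e β γ + j β * b γ)) * j α) y z := by
      simp only [obata, j, D, b, e, Matrix.mul_apply, Matrix.of_apply, Matrix.add_apply,
        Matrix.smul_apply, Matrix.sum_apply, smul_eq_mul]
    have hni : nijenhuis J X y z x = ((1 / 12 : ℝ) •
        ∑ α, (e α α + b α * j α - j α * b α + j α * D X α)) y z := by
      have hb : ∀ a, (b a * j a) y z = - ∑ W, J a X W x * pd y (J a W z) x := by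
        intro a
        have := congrFun (congrFun (hrel y a a) X) z
        have h0 : ∑ γ, epsLC a a γ • D y γ = 0 := by
          fin_cases a <;> simp [epsLC]
        rw [h0] at this
        simp only [j, D, Matrix.mul_apply, Matrix.of_apply, Matrix.add_apply,
          Matrix.zero_apply] at this
        simp only [j, b, Matrix.mul_apply, Matrix.of_apply]
        linarith
      simp only [Matrix.smul_apply, Matrix.sum_apply, Matrix.add_apply, Matrix.sub_apply, hb]
      simp only [nijenhuis, smul_eq_mul]
      congr 1
      refine Finset.sum_congr rfl fun a _ => ?_
      simp only [j, D, b, e, Matrix.mul_apply, Matrix.of_apply,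
        Matrix.smul_apply, Matrix.sum_apply, smul_eq_mul, mul_sub, Finset.sum_sub_distrib]
      ring
    have hN' := hN X y z x hx
    rw [Matrix.sub_apply, Matrix.add_apply, ← hob, ← hni, hN']
    simp only [G, oproiu, j, Matrix.of_apply, Matrix.sum_apply, Matrix.smul_apply, smul_eq_mul,
      Fin.sum_univ_three]
    ring
  have key := alg_main j (D X) b e hj (hD X) he (fun a => ω a X x) G hG α
  have key' := congrFun (congrFun key Y) Z
  simp only [j, D, G, Matrix.mul_apply, Matrix.of_apply, Matrix.add_apply, Matrix.sub_apply,
    Matrix.smul_apply, Matrix.sum_apply, smul_eq_mul, Matrix.zero_apply] at key'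
  rw [← key']
  congr 2
  exact Finset.sum_congr rfl fun W _ => mul_comm _ _
end
end

section
/- Let V = ℝ^{4r} with r ≥ 2 carry a quaternionic triple with components J^α_X^Y, and let R_{XYZ}^W be the components of a curvature-type tensor which normalizes the quaternionic structure (i.e. Σ_W (R_{XYW}^V J^α_Z^W − J^α_W^V R_{XYZ}^W) = 2 ε^{αβγ} 𝓡^γ_{XY} J^β_Z^V for some two-forms 𝓡^γ). Set Ric_{XY} := Σ_Z R_{ZXY}^Z, Π_{XY}^{ZW} := (1/4)(δ_X^Z δ_Y^W + Σ_α J^α_X^Z J^α_Y^W), B_{XY} := (1/(8r))(Ric_{XY} + Ric_{YX}) − (1/(4r(r+2))) Σ_{Z,W} (Π_{XY}^{ZW} + Π_{YX}^{ZW}) Ric_{ZW} + (1/(8(r+1)))(Ric_{XY} − Ric_{YX}), S_{ZW}^{XY} := δ_Z^X δ_W^Y + δ_Z^Y δ_W^X − Σ_α (J^α_Z^X J^α_W^Y + J^α_Z^Y J^α_W^X), and the Ricci part R^{Ric}_{XYZ}^W := Σ_V (S_{ZX}^{WV} B_{YV} − S_{ZY}^{WV} B_{XV}). Then: (a) R^{Ric}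 is antisymmetric in X,Y, satisfies the cyclicity identity, and its Ricci contraction equals Ric_{XY}; and (b) the remainder R^{(W)} := R − R^{Ric} is antisymmetric in X,Y, satisfies the cyclicity identity, has vanishing Ricci contraction, and commutes with every J^α (i.e. Σ_W (R^{(W)}_{XYW}^V J^α_Z^W − J^α_W^V R^{(W)}_{XYZ}^W) = 0). -/
noncomputable section

/-- The Ricci contraction `Ric_{XY} = Σ_Z R_{ZXY}^Z` of a curvature-type tensor. -/
def ricC {n : ℕ} (R : Fin n → Fin n → Fin n → Fin n → ℝ) (X Y : Fin n) : ℝ :=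
  ∑ Z, R Z X Y Z

/-- The hermitian projector `Π_{XY}^{ZW} = (1/4)(δ_X^Z δ_Y^W + Σ_α J^α_X^Z J^α_Y^W)`. -/
def piHerm {n : ℕ} (J : Fin 3 → Fin n → Fin n → ℝ) (X Y Z W : Fin n) : ℝ :=
  (1 / 4) * ((if X = Z then (1 : ℝ) else 0) * (if Y = W then 1 else 0)
    + ∑ α, J α X Z * J α Y W)

/-- The tensor `B_{XY}` built from the Ricci contraction of `R`. -/
def bTensor (r : ℕ) {n : ℕ} (J : Fin 3 → Fin n → Fin n → ℝ)
    (R : Fin n → Fin n → Fin n → Fin n → ℝ) (X Y : Fin n) : ℝ :=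
  (1 / (8 * (r : ℝ))) * (ricC R X Y + ricC R Y X)
    - (1 / (4 * (r : ℝ) * ((r : ℝ) + 2)))
        * ∑ Z, ∑ W, (piHerm J X Y Z W + piHerm J Y X Z W) * ricC R Z W
    + (1 / (8 * ((r : ℝ) + 1))) * (ricC R X Y - ricC R Y X)

/-- The tensor `S_{ZW}^{XY} = δ_Z^X δ_W^Y + δ_Z^Y δ_W^X − Σ_α (J^α_Z^X J^α_W^Y + J^α_Z^Y J^α_W^X)`. -/
def quatS {n : ℕ} (J : Fin 3 → Fin n → Fin n → ℝ) (Z W X Y : Fin n) : ℝ :=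
  (if Z = X then (1 : ℝ) else 0) * (if W = Y then 1 else 0)
    + (if Z = Y then (1 : ℝ) else 0) * (if W = X then 1 else 0)
    - ∑ α, (J α Z X * J α W Y + J α Z Y * J α W X)

/-- The Ricci part `R^{Ric}_{XYZ}^W = Σ_V (S_{ZX}^{WV} B_{YV} − S_{ZY}^{WV} B_{XV})`. -/
def riccipart (r : ℕ) {n : ℕ} (J : Fin 3 → Fin n → Fin n → ℝ)
    (R : Fin n → Fin n → Fin n → Fin n → ℝ) (X Y Z W : Fin n) : ℝ :=
  ∑ V, (quatS J Z X W V * bTensor r J R Y V - quatS J Z Y W V * bTensor r J R X V)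

/-- The multiplication table of a quaternionic triple of matrices. -/
def QTriple {n : ℕ} (i j k : Matrix (Fin n) (Fin n) ℝ) : Prop :=
  i * i = -1 ∧ j * j = -1 ∧ k * k = -1 ∧ i * j = k ∧ j * i = -k ∧ j * k = i ∧ k * j = -i ∧
    k * i = j ∧ i * k = -j

theorem QTriple.cyc {n : ℕ} {i j k : Matrix (Fin n) (Fin n) ℝ} (h : QTriple i j k) :
    QTriple j k i := by
  obtain ⟨h1, h2, h3, h4, h5, h6, h7, h8, h9⟩ := h
  exact ⟨h2, h3, h1, h6, h7, h8, h9, h4, h5⟩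

theorem QTriple.tr {n : ℕ} {i j k : Matrix (Fin n) (Fin n) ℝ} (h : QTriple i j k) :
    i.trace = 0 := by
  obtain ⟨h1, h2, h3, h4, h5, h6, h7, h8, h9⟩ := h
  have := Matrix.trace_mul_comm j k
  rw [h6, h7, Matrix.trace_neg] at this
  linarith

/-- The operator `X ↦ Σ J X Jᵀ`. -/
def sOp {n : ℕ} (i j k X : Matrix (Fin n) (Fin n) ℝ) : Matrix (Fin n) (Fin n) ℝ :=
  i * X * i.transpose + j * X * j.transpose + k * X * k.transpose

theorem sandwich {n : ℕ} (a b X : Matrix (Fin n) (Fin n) ℝ) :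
    a * (b * X * b.transpose) * a.transpose = (a * b) * X * (a * b).transpose := by
  rw [Matrix.transpose_mul]; noncomm_ring

theorem sOp_sOp {n : ℕ} {i j k : Matrix (Fin n) (Fin n) ℝ} (h : QTriple i j k)
    (X : Matrix (Fin n) (Fin n) ℝ) :
    sOp i j k (sOp i j k X) = (2 : ℝ) • sOp i j k X + (3 : ℝ) • X := by
  obtain ⟨h1, h2, h3, h4, h5, h6, h7, h8, h9⟩ := h
  simp only [sOp, mul_add, add_mul, sandwich, h1, h2, h3, h4, h5, h6, h7, h8, h9]
  simp only [Matrix.transpose_neg, Matrix.transpose_one, neg_mul, mul_neg, neg_neg, one_mul,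
    mul_one]
  module

theorem eigen_zero {E : Type*} [AddCommGroup E] [Module ℝ E] (q1 q2 q3 : E →ₗ[ℝ] E)
    (c12 : ∀ x, q1 (q2 x) - q2 (q1 x) = (2 : ℝ) • q3 x)
    (c23 : ∀ x, q2 (q3 x) - q3 (q2 x) = (2 : ℝ) • q1 x)
    (c31 : ∀ x, q3 (q1 x) - q1 (q3 x) = (2 : ℝ) • q2 x)
    (Q : E →ₗ[ℝ] E) (hQ : ∀ x, Q x = q1 (q1 x) + q2 (q2 x) + q3 (q3 x))
    (hQQ : ∀ x, Q (Q x) = (-8 : ℝ) • Q x)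
    (r : ℝ) (hr : 2 ≤ r) (d1 d2 d3 : E)
    (h1 : (2 * r) • d1 = q3 d2 - q2 d3)
    (h2 : (2 * r) • d2 = q1 d3 - q3 d1)
    (h3 : (2 * r) • d3 = q2 d1 - q1 d2) : d1 = 0 := by
  have hdiv : q1 d1 + q2 d2 + q3 d3 = 0 := by
    have e1 := congrArg q1 h1
    have e2 := congrArg q2 h2
    have e3 := congrArg q3 h3
    simp only [map_smul, map_sub] at e1 e2 e3
    have : (2 * r + 2) • (q1 d1 + q2 d2 + q3 d3) = 0 := by
      linear_combination (norm := module) e1 + e2 + e3 - c12 d3 - c23 d1 - c31 d2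
    exact (smul_eq_zero.mp this).resolve_left (by linarith)
  have e2 := congrArg q3 h2
  have e3 := congrArg q2 h3
  have ed := congrArg q1 hdiv
  simp only [map_smul, map_sub, map_add, map_zero] at e2 e3 ed
  have hq : Q d1 = (-(4 * r ^ 2 + 4 * r)) • d1 := by
    rw [hQ]
    linear_combination (norm := module) (2 * r + 2) • h1 + e2 - e3 + ed + c31 d3 - c12 d2
  have hqq := hQQ d1
  rw [hq, map_smul, hq] at hqq
  have : ((4 * r ^ 2 + 4 * r) * (4 * r ^ 2 + 4 * r - 8)) • d1 = 0 := by
    linear_combination (norm := module) hqq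
  refine (smul_eq_zero.mp this).resolve_left (mul_ne_zero ?_ ?_) <;> nlinarith

/-- The operator `X ↦ J X + X Jᵀ`. -/
def qOp {n : ℕ} (i : Matrix (Fin n) (Fin n) ℝ) :
    Matrix (Fin n) (Fin n) ℝ →ₗ[ℝ] Matrix (Fin n) (Fin n) ℝ :=
  LinearMap.mulLeft ℝ i + LinearMap.mulRight ℝ i.transpose

theorem qOp_apply {n : ℕ} (i X : Matrix (Fin n) (Fin n) ℝ) :
    qOp i X = i * X + X * i.transpose := rfl

theorem qOp_comm {n : ℕ} {i j k : Matrix (Fin n) (Fin n) ℝ} (h : QTriple i j k)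
    (X : Matrix (Fin n) (Fin n) ℝ) :
    qOp i (qOp j X) - qOp j (qOp i X) = (2 : ℝ) • qOp k X := by
  obtain ⟨h1, h2, h3, h4, h5, h6, h7, h8, h9⟩ := h
  have e : qOp i (qOp j X) - qOp j (qOp i X) = (i * j) * X - (j * i) * X
      + X * (i * j).transpose - X * (j * i).transpose := by
    simp only [qOp_apply, Matrix.transpose_mul]; noncomm_ring
  rw [e, h4, h5, qOp_apply, Matrix.transpose_neg, mul_neg, neg_mul]
  module

theorem qOp_sq {n : ℕ} {i : Matrix (Fin n) (Fin n) ℝ} (h : i * i = -1)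
    (X : Matrix (Fin n) (Fin n) ℝ) :
    qOp i (qOp i X) = (-2 : ℝ) • X + (2 : ℝ) • (i * X * i.transpose) := by
  have e : qOp i (qOp i X) = (i * i) * X
      + X * (i * i).transpose + (i * X * i.transpose + i * X * i.transpose) := by
    simp only [qOp_apply, Matrix.transpose_mul]; noncomm_ring
  rw [e, h, Matrix.transpose_neg, mul_neg, neg_mul, Matrix.transpose_one, one_mul, mul_one]
  module

theorem d_zero {n : ℕ} {i j k : Matrix (Fin n) (Fin n) ℝ} (h : QTriple i j k)
    (r : ℝ) (hr : 2 ≤ r) (d1 d2 d3 : Matrix (Fin n) (Fin n) ℝ)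
    (h1 : (2 * r) • d1 = qOp k d2 - qOp j d3)
    (h2 : (2 * r) • d2 = qOp i d3 - qOp k d1)
    (h3 : (2 * r) • d3 = qOp j d1 - qOp i d2) : d1 = 0 := by
  have hs : ∀ x, (qOp i ∘ₗ qOp i + qOp j ∘ₗ qOp j + qOp k ∘ₗ qOp k) x
      = (-6 : ℝ) • x + (2 : ℝ) • sOp i j k x := by
    intro x
    obtain ⟨h1, h2, h3, -⟩ := h
    simp only [LinearMap.add_apply, LinearMap.comp_apply, qOp_sq h1, qOp_sq h2, qOp_sq h3, sOp]
    module
  refine eigen_zero (qOp i) (qOp j) (qOp k) (qOp_comm h) (qOp_comm h.cyc) (qOp_comm h.cyc.cyc)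
    (qOp i ∘ₗ qOp i + qOp j ∘ₗ qOp j + qOp k ∘ₗ qOp k) (fun x => rfl) ?_ r hr d1 d2 d3 h1 h2 h3
  intro x
  rw [hs (_ : Matrix (Fin n) (Fin n) ℝ), hs x]
  have e : ∀ y, sOp i j k ((-6 : ℝ) • x + (2 : ℝ) • y)
      = (-6 : ℝ) • sOp i j k x + (2 : ℝ) • sOp i j k y := by
    intro y
    simp only [sOp, mul_add, add_mul, mul_smul_comm, smul_mul_assoc]
    module
  rw [e, sOp_sOp h]
  module

/-- The contraction of the Bianchi identity with one of the complex structures. -/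
theorem contr {n : ℕ} {i j k : Matrix (Fin n) (Fin n) ℝ} (h : QTriple i j k)
    (r : ℝ) (hn : (n : ℝ) = 4 * r)
    (D : Fin n → Fin n → Matrix (Fin n) (Fin n) ℝ)
    (hanti : ∀ X Y Z W, D X Y Z W = - D Y X Z W)
    (hb : ∀ X Y Z W, D X Y Z W + D Z X Y W + D Y Z X W = 0)
    (hric : ∀ X Y, ∑ Z, D Z X Y Z = 0)
    (d1 d2 d3 : Matrix (Fin n) (Fin n) ℝ)
    (a2 : ∀ X Y, d2 X Y = - d2 Y X) (a3 : ∀ X Y, d3 X Y = - d3 Y X)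
    (E1 : ∀ X Y, i * D X Y - D X Y * i = (2 * d3 X Y) • j - (2 * d2 X Y) • k)
    (E2 : ∀ X Y, j * D X Y - D X Y * j = (2 * d1 X Y) • k - (2 * d3 X Y) • i) :
    (2 * r) • d1 = qOp k d2 - qOp j d3 := by
  have ht : ∀ X Y, (D X Y * i).trace = 4 * r * d1 X Y := by
    intro X Y
    have e := congrArg (fun M => (M * k).trace) (E2 X Y)
    have tj := h.cyc.tr
    obtain ⟨h1, h2, h3, h4, h5, h6, h7, h8, h9⟩ := h
    simp only [sub_mul, Matrix.trace_sub, smul_mul_assoc, h3, h9, Matrix.trace_smul,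
      Matrix.trace_neg, Matrix.trace_one, tj, Fintype.card_fin, hn, smul_eq_mul] at e
    rw [mul_assoc, Matrix.trace_mul_comm j, mul_assoc, mul_assoc, h7, h6, mul_neg,
      Matrix.trace_neg] at e
    linarith
  have hK : ∀ X Y, ∑ Z, (D Z X * i) Y Z = -2 * ((j * d3) Y X - (k * d2) Y X) := by
    intro X Y
    have e : ∀ Z, (D Z X * i) Y Z = (i * D Z X) Y Z - ((2 * d3 Z X) * j Y Z
        - (2 * d2 Z X) * k Y Z) := by
      intro Z
      have := congrFun (congrFun (E1 Z X) Y) Z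
      simp only [Matrix.sub_apply, Matrix.smul_apply, smul_eq_mul] at this
      linarith
    have e0 : ∑ Z, (i * D Z X) Y Z = 0 := by
      simp only [Matrix.mul_apply]
      rw [Finset.sum_comm]
      simp only [← Finset.mul_sum, hric, mul_zero, Finset.sum_const_zero]
    simp only [e, Finset.sum_sub_distrib, e0]
    simp only [Matrix.mul_apply, mul_sub, Finset.mul_sum]
    rw [zero_sub, neg_sub, ← Finset.sum_sub_distrib, ← Finset.sum_sub_distrib]
    refine Finset.sum_congr rfl fun Z _ => ?_
    ring
  ext X Y
  have hB : (D X Y * i).trace + ∑ Z, (D Z X * i) Y Z - ∑ Z, (D Z Y * i) X Z = 0 := by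
    simp only [Matrix.trace, Matrix.diag, Matrix.mul_apply]
    simp only [← Finset.sum_add_distrib, ← Finset.sum_sub_distrib]
    refine Finset.sum_eq_zero fun Z _ => Finset.sum_eq_zero fun W _ => ?_
    linear_combination i W Z * hb X Y Z W - i W Z * hanti Y Z X W
  rw [ht, hK, hK] at hB
  have t3 : (d3 * j.transpose) X Y = -(j * d3) Y X := by
    simp only [Matrix.mul_apply, Matrix.transpose_apply, ← Finset.sum_neg_distrib]
    refine Finset.sum_congr rfl fun Z _ => ?_
    rw [a3 X Z]; ring
  have t2 : (d2 * k.transpose) X Y = -(k * d2) Y X := by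
    simp only [Matrix.mul_apply, Matrix.transpose_apply, ← Finset.sum_neg_distrib]
    refine Finset.sum_congr rfl fun Z _ => ?_
    rw [a2 X Z]; ring
  simp only [Matrix.smul_apply, smul_eq_mul, Matrix.sub_apply, qOp_apply, Matrix.add_apply, t2, t3]
  linarith

theorem key {n : ℕ} {i j k : Matrix (Fin n) (Fin n) ℝ} (h : QTriple i j k)
    (r : ℝ) (hr : 2 ≤ r) (hn : (n : ℝ) = 4 * r)
    (D : Fin n → Fin n → Matrix (Fin n) (Fin n) ℝ)
    (hanti : ∀ X Y Z W, D X Y Z W = - D Y X Z W)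
    (hb : ∀ X Y Z W, D X Y Z W + D Z X Y W + D Y Z X W = 0)
    (hric : ∀ X Y, ∑ Z, D Z X Y Z = 0)
    (d1 d2 d3 : Matrix (Fin n) (Fin n) ℝ)
    (a1 : ∀ X Y, d1 X Y = - d1 Y X)
    (a2 : ∀ X Y, d2 X Y = - d2 Y X) (a3 : ∀ X Y, d3 X Y = - d3 Y X)
    (E1 : ∀ X Y, i * D X Y - D X Y * i = (2 * d3 X Y) • j - (2 * d2 X Y) • k)
    (E2 : ∀ X Y, j * D X Y - D X Y * j = (2 * d1 X Y) • k - (2 * d3 X Y) • i)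
    (E3 : ∀ X Y, k * D X Y - D X Y * k = (2 * d2 X Y) • i - (2 * d1 X Y) • j) :
    d1 = 0 ∧ d2 = 0 ∧ d3 = 0 := by
  have f1 := contr h r hn D hanti hb hric d1 d2 d3 a2 a3 E1 E2
  have f2 := contr h.cyc r hn D hanti hb hric d2 d3 d1 a3 a1 E2 E3
  have f3 := contr h.cyc.cyc r hn D hanti hb hric d3 d1 d2 a1 a2 E3 E1
  exact ⟨d_zero h r hr _ _ _ f1 f2 f3, d_zero h.cyc r hr _ _ _ f2 f3 f1,
    d_zero h.cyc.cyc r hr _ _ _ f3 f1 f2⟩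

/-- `N - Σ J N J`, which commutes with the quaternionic triple. -/
def hOp {n : ℕ} (i j k N : Matrix (Fin n) (Fin n) ℝ) : Matrix (Fin n) (Fin n) ℝ :=
  N - i * N * i - j * N * j - k * N * k

theorem hOp_comm {n : ℕ} {i j k : Matrix (Fin n) (Fin n) ℝ} (h : QTriple i j k)
    (N : Matrix (Fin n) (Fin n) ℝ) : i * hOp i j k N = hOp i j k N * i := by
  obtain ⟨h1, h2, h3, h4, h5, h6, h7, h8, h9⟩ := h
  have l : i * hOp i j k N = i * N - (i * i) * N * i - (i * j) * N * j - (i * k) * N * k := by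
    simp only [hOp]; noncomm_ring
  have r : hOp i j k N * i = N * i - i * N * (i * i) - j * N * (j * i) - k * N * (k * i) := by
    simp only [hOp]; noncomm_ring
  rw [l, r, h1, h4, h9, h5, h8]
  noncomm_ring

theorem hOp_cyc {n : ℕ} (i j k N : Matrix (Fin n) (Fin n) ℝ) : hOp i j k N = hOp j k i N := by
  simp only [hOp]; abel

theorem comm_formula {n : ℕ} {i j k : Matrix (Fin n) (Fin n) ℝ} (h : QTriple i j k)
    (N N' : Matrix (Fin n) (Fin n) ℝ) (b e1 e2 e3 : ℝ) (M : Matrix (Fin n) (Fin n) ℝ)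
    (hM : M = b • 1 + hOp i j k N - hOp i j k N' - e1 • i - e2 • j - e3 • k) :
    i * M - M * i = (2 * e3) • j - (2 * e2) • k := by
  have c := hOp_comm h N
  have c' := hOp_comm h N'
  obtain ⟨h1, h2, h3, h4, h5, h6, h7, h8, h9⟩ := h
  rw [hM]
  simp only [mul_add, mul_sub, add_mul, sub_mul, mul_smul_comm, smul_mul_assoc, mul_one, one_mul,
    c, c', h1, h4, h5, h8, h9]
  module

theorem qtriple_of {n : ℕ} (J : Fin 3 → Fin n → Fin n → ℝ)
    (hJ : ∀ α β X Z, ∑ W, J α X W * J β W Z =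
      (if α = β then (-1 : ℝ) else 0) * (if X = Z then 1 else 0)
        + ∑ γ, epsLC α β γ * J γ X Z) :
    QTriple (Matrix.of (J 0)) (Matrix.of (J 1)) (Matrix.of (J 2)) := by
  refine ⟨?_, ?_, ?_, ?_, ?_, ?_, ?_, ?_, ?_⟩ <;>
  · ext X Z
    simp [Matrix.mul_apply, hJ, epsLC, Fin.sum_univ_three, Matrix.one_apply]
    try (split_ifs <;> simp)

theorem ric_formula {n : ℕ} (J : Fin 3 → Fin n → Fin n → ℝ) (r : ℕ)
    (R : Fin n → Fin n → Fin n → Fin n → ℝ) (X Y Z W : Fin n) :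
    riccipart r J R X Y Z W =
      (if Z = W then 1 else 0) * (bTensor r J R Y X - bTensor r J R X Y)
      + (if X = W then 1 else 0) * bTensor r J R Y Z
      - (if Y = W then 1 else 0) * bTensor r J R X Z
      - ∑ α, (J α Z W * (∑ V, J α X V * bTensor r J R Y V - ∑ V, J α Y V * bTensor r J R X V)
          + J α X W * (∑ V, J α Z V * bTensor r J R Y V)
          - J α Y W * (∑ V, J α Z V * bTensor r J R X V)) := by
  have e : ∀ A B C, ∑ V, quatS J A B W V * bTensor r J R C V
      = (if A = W then 1 else 0) * bTensor r J R C B + (if B = W then 1 else 0) * bTensor r J R C A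
      - ∑ α, (J α A W * (∑ V, J α B V * bTensor r J R C V)
          + J α B W * (∑ V, J α A V * bTensor r J R C V)) := by
    intro A B C
    generalize bTensor r J R = T
    have e1 : (if A = W then (1 : ℝ) else 0) * T C B
        = ∑ V, (if A = W then (1 : ℝ) else 0) * (if B = V then 1 else 0) * T C V := by
      simp [mul_assoc, ← Finset.mul_sum]
    have e2 : (if B = W then (1 : ℝ) else 0) * T C A
        = ∑ V, (if A = V then (1 : ℝ) else 0) * (if B = W then 1 else 0) * T C V := by
      simp [mul_comm]
    rw [e1, e2]
    simp only [quatS, Fin.sum_univ_three, Finset.mul_sum, ← Finset.sum_add_distrib,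
      ← Finset.sum_sub_distrib]
    refine Finset.sum_congr rfl fun V _ => ?_
    ring
  rw [riccipart, Finset.sum_sub_distrib, e, e]
  simp only [Fin.sum_univ_three]
  ring

theorem sOp_apply {n : ℕ} (J : Fin 3 → Fin n → Fin n → ℝ) (T : Matrix (Fin n) (Fin n) ℝ)
    (X Y : Fin n) :
    sOp (Matrix.of (J 0)) (Matrix.of (J 1)) (Matrix.of (J 2)) T X Y
      = ∑ Z, ∑ W, (∑ α, J α X Z * J α Y W) * T Z W := by
  rw [Finset.sum_comm]
  simp only [sOp, Matrix.add_apply, Matrix.mul_apply, Matrix.of_apply, Matrix.transpose_apply,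
    Fin.sum_univ_three, Finset.sum_mul, ← Finset.sum_add_distrib]
  refine Finset.sum_congr rfl fun V _ => Finset.sum_congr rfl fun V _ => ?_
  ring

theorem pi_apply {n : ℕ} (J : Fin 3 → Fin n → Fin n → ℝ) (T : Matrix (Fin n) (Fin n) ℝ)
    (X Y : Fin n) :
    ∑ Z, ∑ W, piHerm J X Y Z W * T Z W = (1 / 4) * (T X Y
      + sOp (Matrix.of (J 0)) (Matrix.of (J 1)) (Matrix.of (J 2)) T X Y) := by
  have e1 : T X Y = ∑ Z, ∑ W, (if X = Z then (1 : ℝ) else 0) * (if Y = W then 1 else 0) * T Z W := by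
    simp [mul_assoc]
  rw [sOp_apply]
  conv_rhs => rw [e1]
  simp only [← Finset.sum_add_distrib, Finset.mul_sum, piHerm]
  refine Finset.sum_congr rfl fun V _ => Finset.sum_congr rfl fun V _ => ?_
  ring

theorem sOp_transpose {n : ℕ} (i j k T : Matrix (Fin n) (Fin n) ℝ) :
    sOp i j k T.transpose = (sOp i j k T).transpose := by
  simp only [sOp, Matrix.transpose_add, Matrix.transpose_mul, Matrix.transpose_transpose, mul_assoc]

theorem b_formula {n : ℕ} (J : Fin 3 → Fin n → Fin n → ℝ) (r : ℕ)
    (R : Fin n → Fin n → Fin n → Fin n → ℝ) (T S : Matrix (Fin n) (Fin n) ℝ)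
    (hT : T = Matrix.of (ricC R))
    (hS : S = sOp (Matrix.of (J 0)) (Matrix.of (J 1)) (Matrix.of (J 2)) T) :
    Matrix.of (bTensor r J R) = (1 / (8 * (r : ℝ))) • (T + T.transpose)
      - (1 / (4 * (r : ℝ) * ((r : ℝ) + 2)) / 4) • (T + T.transpose + S + S.transpose)
      + (1 / (8 * ((r : ℝ) + 1))) • (T - T.transpose) := by
  ext X Y
  have e := pi_apply J T X Y
  have e' := pi_apply J T Y X
  rw [← hS] at e e'
  simp only [hT, Matrix.of_apply] at e e'
  simp only [Matrix.of_apply, bTensor, add_mul, Finset.sum_add_distrib, e, e', Matrix.add_apply,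
    Matrix.sub_apply, Matrix.smul_apply, smul_eq_mul, Matrix.transpose_apply, hT]
  ring

theorem sb_formula {n : ℕ} {i j k : Matrix (Fin n) (Fin n) ℝ} (h : QTriple i j k)
    (T S B : Matrix (Fin n) (Fin n) ℝ) (a b c : ℝ) (hS : S = sOp i j k T)
    (hB : B = a • (T + T.transpose) - b • (T + T.transpose + S + S.transpose)
      + c • (T - T.transpose)) :
    sOp i j k B = a • (S + S.transpose)
      - b • ((3 : ℝ) • (S + S.transpose) + (3 : ℝ) • (T + T.transpose))
      + c • (S - S.transpose) := by
  have hSS : sOp i j k S = (2 : ℝ) • S + (3 : ℝ) • T := by rw [hS, sOp_sOp h]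
  have ha : ∀ x y, sOp i j k (x + y) = sOp i j k x + sOp i j k y := by
    intro x y; simp only [sOp, mul_add, add_mul]; abel
  have hs : ∀ x y, sOp i j k (x - y) = sOp i j k x - sOp i j k y := by
    intro x y; simp only [sOp, mul_sub, sub_mul]; abel
  have hm : ∀ (t : ℝ) x, sOp i j k (t • x) = t • sOp i j k x := by
    intro t x; simp only [sOp, mul_smul_comm, smul_mul_assoc, smul_add]
  rw [hB]
  simp only [ha, hs, hm, sOp_transpose, hSS, ← hS, Matrix.transpose_add, Matrix.transpose_smul]
  module

theorem ric_trace {n : ℕ} (r : ℕ) (hr : 2 ≤ r) (hn : (n : ℝ) = 4 * r)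
    (J : Fin 3 → Fin n → Fin n → ℝ)
    (h : QTriple (Matrix.of (J 0)) (Matrix.of (J 1)) (Matrix.of (J 2)))
    (R : Fin n → Fin n → Fin n → Fin n → ℝ) (X Y : Fin n) :
    ∑ Z, riccipart r J R Z X Y Z = ricC R X Y := by
  obtain ⟨T, hT⟩ : ∃ T, T = Matrix.of (ricC R) := ⟨_, rfl⟩
  obtain ⟨S, hS⟩ : ∃ S, S = sOp (Matrix.of (J 0)) (Matrix.of (J 1)) (Matrix.of (J 2)) T := ⟨_, rfl⟩
  have hB := b_formula J r R T S hT hS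
  have hsB := sb_formula h T S _ _ _ _ hS hB
  obtain ⟨B, hBd⟩ : ∃ B, B = Matrix.of (bTensor r J R) := ⟨_, rfl⟩
  rw [← hBd] at hB hsB
  have t0 : ∑ Z, J 0 Z Z = 0 := h.tr
  have t1 : ∑ Z, J 1 Z Z = 0 := h.cyc.tr
  have t2 : ∑ Z, J 2 Z Z = 0 := h.cyc.cyc.tr
  have sq : ∀ α, ∀ A V, ∑ Z, J α A Z * J α Z V = -(if A = V then 1 else 0) := by
    intro α A V
    obtain ⟨h1, h2, h3, -⟩ := h
    have : Matrix.of (J α) * Matrix.of (J α) = -1 := by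
      fin_cases α
      · exact h1
      · exact h2
      · exact h3
    have := congrFun (congrFun this A) V
    simpa [Matrix.mul_apply, Matrix.one_apply] using this
  have hsq : ∀ α, ∑ Z, J α Y Z * ∑ V, J α Z V * B X V = - B X Y := by
    intro α
    simp only [Finset.mul_sum, ← mul_assoc]
    rw [Finset.sum_comm]
    simp only [← Finset.sum_mul, sq]
    simp
  have hst : ∀ A C, sOp (Matrix.of (J 0)) (Matrix.of (J 1)) (Matrix.of (J 2)) B A C
      = ∑ Z, ∑ α, J α A Z * ∑ V, J α C V * B Z V := by
    intro A C
    rw [sOp_apply]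
    simp only [Finset.mul_sum, Finset.sum_mul]
    refine Finset.sum_congr rfl fun Z _ => ?_
    rw [Finset.sum_comm]
    simp only [mul_assoc]
  have main : ∑ Z, riccipart r J R Z X Y Z = (4 * r + 4) * B X Y - (B Y X + B X Y)
      + sOp (Matrix.of (J 0)) (Matrix.of (J 1)) (Matrix.of (J 2)) B X Y
      + sOp (Matrix.of (J 0)) (Matrix.of (J 1)) (Matrix.of (J 2)) B Y X := by
    have hb : ∀ A C, bTensor r J R A C = B A C := fun A C => by rw [hBd]; rfl
    rw [hst, hst]
    have q0 := hsq 0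
    have q1 := hsq 1
    have q2 := hsq 2
    have d1 : ∑ Z, (if Y = Z then (1 : ℝ) else 0) * (B X Z - B Z X) = B X Y - B Y X := by simp
    have d3 : ∑ Z, (if X = Z then (1 : ℝ) else 0) * B Z Y = B X Y := by simp
    have tt : ∀ α, (∑ Z, J α Z Z = 0) → ∑ Z, J α Z Z * (∑ V, J α Y V * B X V) = 0 := by
      intro α h0
      rw [← Finset.sum_mul, h0, zero_mul]
    have t0' := tt 0 t0
    have t1' := tt 1 t1
    have t2' := tt 2 t2
    simp only [ric_formula, hb, Fin.sum_univ_three, Finset.sum_add_distrib, Finset.sum_sub_distrib,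
      mul_sub, ↓reduceIte, one_mul, Finset.sum_const, Finset.card_univ, Fintype.card_fin,
      nsmul_eq_mul, hn] at d1 ⊢
    linarith
  rw [main]
  have x1 := congrFun (congrFun hB X) Y
  have x2 := congrFun (congrFun hB Y) X
  have x3 := congrFun (congrFun hsB X) Y
  have x4 := congrFun (congrFun hsB Y) X
  simp only [Matrix.add_apply,
    Matrix.sub_apply, Matrix.smul_apply, smul_eq_mul, Matrix.transpose_apply] at x1 x2 x3 x4
  have hr0 : (r : ℝ) ≠ 0 := by positivity
  have hr1 : (r : ℝ) + 1 ≠ 0 := by positivity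
  have hr2 : (r : ℝ) + 2 ≠ 0 := by positivity
  have hxy : ricC R X Y = T X Y := by rw [hT]; rfl
  rw [x1, x2, x3, x4, hxy]
  field_simp
  ring

theorem ric_matrix {n : ℕ} (J : Fin 3 → Fin n → Fin n → ℝ) (r : ℕ)
    (R : Fin n → Fin n → Fin n → Fin n → ℝ) (X Y : Fin n) :
    (Matrix.of (riccipart r J R X Y)) =
      (bTensor r J R Y X - bTensor r J R X Y) • (1 : Matrix (Fin n) (Fin n) ℝ)
      + hOp (Matrix.of (J 0)) (Matrix.of (J 1)) (Matrix.of (J 2))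
          (Matrix.of fun Z W => bTensor r J R Y Z * if X = W then 1 else 0)
      - hOp (Matrix.of (J 0)) (Matrix.of (J 1)) (Matrix.of (J 2))
          (Matrix.of fun Z W => bTensor r J R X Z * if Y = W then 1 else 0)
      - (∑ V, J 0 X V * bTensor r J R Y V - ∑ V, J 0 Y V * bTensor r J R X V) • Matrix.of (J 0)
      - (∑ V, J 1 X V * bTensor r J R Y V - ∑ V, J 1 Y V * bTensor r J R X V) • Matrix.of (J 1)
      - (∑ V, J 2 X V * bTensor r J R Y V - ∑ V, J 2 Y V * bTensor r J R X V) • Matrix.of (J 2)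
      := by
  ext Z W
  have e : ∀ α A C, (Matrix.of (J α) * (Matrix.of fun Z W => bTensor r J R C Z *
      if A = W then (1 : ℝ) else 0) * Matrix.of (J α)) Z W
      = J α A W * (∑ V, J α Z V * bTensor r J R C V) := by
    intro α A C
    simp only [Matrix.mul_apply, Matrix.of_apply, ← mul_assoc, ← Finset.sum_mul]
    simp [mul_comm]
  simp only [Matrix.of_apply, ric_formula, hOp, Matrix.add_apply, Matrix.sub_apply,
    Matrix.smul_apply, smul_eq_mul, e, Fin.sum_univ_three, Matrix.one_apply]
  ring

/-- decomposition of a curvature-type tensor normalizing a quaternionic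
structure on `ℝ^{4r}` (`r ≥ 2`) into its Ricci part and its Weyl part.  The Ricci part is
a curvature tensor whose Ricci contraction is that of `R`, and the remainder is a
Ricci-flat curvature tensor commuting with every `J^α`. -/
theorem stmt_14 (r : ℕ) (hr : 2 ≤ r)
    (J : Fin 3 → Fin (4 * r) → Fin (4 * r) → ℝ)
    (hJ : ∀ α β X Z, ∑ W, J α X W * J β W Z =
      (if α = β then (-1 : ℝ) else 0) * (if X = Z then 1 else 0)
        + ∑ γ, epsLC α β γ * J γ X Z)
    (R : Fin (4 * r) → Fin (4 * r) → Fin (4 * r) → Fin (4 * r) → ℝ)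
    (hanti : ∀ X Y Z W, R X Y Z W = - R Y X Z W)
    (hbianchi : ∀ X Y Z W, R X Y Z W + R Z X Y W + R Y Z X W = 0)
    (𝓡 : Fin 3 → Fin (4 * r) → Fin (4 * r) → ℝ)
    (h𝓡anti : ∀ γ X Y, 𝓡 γ X Y = - 𝓡 γ Y X)
    (hnorm : ∀ α X Y Z V,
      ∑ W, (R X Y W V * J α Z W - J α W V * R X Y Z W)
        = 2 * ∑ β, ∑ γ, epsLC α β γ * 𝓡 γ X Y * J β Z V) :
    ((∀ X Y Z W, riccipart r J R X Y Z W = - riccipart r J R Y X Z W) ∧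
     (∀ X Y Z W, riccipart r J R X Y Z W + riccipart r J R Z X Y W
        + riccipart r J R Y Z X W = 0) ∧
     (∀ X Y, ∑ Z, riccipart r J R Z X Y Z = ricC R X Y)) ∧
    ((∀ X Y Z W, R X Y Z W - riccipart r J R X Y Z W
        = - (R Y X Z W - riccipart r J R Y X Z W)) ∧
     (∀ X Y Z W, (R X Y Z W - riccipart r J R X Y Z W)
        + (R Z X Y W - riccipart r J R Z X Y W)
        + (R Y Z X W - riccipart r J R Y Z X W) = 0) ∧
     (∀ X Y, ∑ Z, (R Z X Y Z - riccipart r J R Z X Y Z) = 0) ∧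
     (∀ α X Y Z V,
        ∑ W, ((R X Y W V - riccipart r J R X Y W V) * J α Z W
          - J α W V * (R X Y Z W - riccipart r J R X Y Z W)) = 0)) := by
  have h := qtriple_of J hJ
  have hn : ((4 * r : ℕ) : ℝ) = 4 * (r : ℝ) := by push_cast; ring
  have hr' : (2 : ℝ) ≤ r := by exact_mod_cast hr
  have A1 : ∀ X Y Z W, riccipart r J R X Y Z W = - riccipart r J R Y X Z W := by
    intro X Y Z W
    simp only [riccipart, ← Finset.sum_neg_distrib, neg_sub]
  have A2 : ∀ X Y Z W, riccipart r J R X Y Z W + riccipart r J R Z X Y W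
        + riccipart r J R Y Z X W = 0 := by
    intro X Y Z W
    simp only [ric_formula, Fin.sum_univ_three]
    ring
  have A3 : ∀ X Y, ∑ Z, riccipart r J R Z X Y Z = ricC R X Y := ric_trace r hr hn J h R
  have B1 : ∀ X Y Z W, R X Y Z W - riccipart r J R X Y Z W
        = - (R Y X Z W - riccipart r J R Y X Z W) := by
    intro X Y Z W
    rw [hanti, A1]; ring
  have B2 : ∀ X Y Z W, (R X Y Z W - riccipart r J R X Y Z W)
        + (R Z X Y W - riccipart r J R Z X Y W)
        + (R Y Z X W - riccipart r J R Y Z X W) = 0 := by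
    intro X Y Z W
    linear_combination hbianchi X Y Z W - A2 X Y Z W
  have B3 : ∀ X Y, ∑ Z, (R Z X Y Z - riccipart r J R Z X Y Z) = 0 := by
    intro X Y
    rw [Finset.sum_sub_distrib, A3, ricC, sub_self]
  refine ⟨⟨A1, A2, A3⟩, B1, B2, B3, ?_⟩
  obtain ⟨e, he⟩ : ∃ e : Fin 3 → Matrix (Fin (4 * r)) (Fin (4 * r)) ℝ, ∀ α X Y,
    e α X Y = ∑ V, J α X V * bTensor r J R Y V - ∑ V, J α Y V * bTensor r J R X V :=
    ⟨fun α => Matrix.of fun X Y => _, fun α X Y => rfl⟩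
  obtain ⟨D, hD⟩ : ∃ D : Fin (4 * r) → Fin (4 * r) → Matrix (Fin (4 * r)) (Fin (4 * r)) ℝ,
    ∀ X Y, D X Y = Matrix.of (R X Y) - Matrix.of (riccipart r J R X Y) := ⟨_, fun X Y => rfl⟩
  have hDa : ∀ X Y Z W, D X Y Z W = R X Y Z W - riccipart r J R X Y Z W := by
    intro X Y Z W; rw [hD]; rfl
  have hnm : ∀ α X Y, Matrix.of (J α) * Matrix.of (R X Y) - Matrix.of (R X Y) * Matrix.of (J α)
      = ∑ β, ∑ γ, (2 * epsLC α β γ * 𝓡 γ X Y) • Matrix.of (J β) := by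
    intro α X Y
    ext Z V
    have := hnorm α X Y Z V
    simp only [Matrix.sub_apply, Matrix.mul_apply, Matrix.of_apply, Matrix.sum_apply,
      Matrix.smul_apply, smul_eq_mul]
    rw [← Finset.sum_sub_distrib]
    convert this using 1
    · exact Finset.sum_congr rfl fun W _ => by ring
    · simp only [Finset.mul_sum, mul_assoc]
  have F := fun X Y => ric_matrix J r R X Y
  simp only [← he] at F
  have C0 := fun X Y => comm_formula h _ _ _ _ _ _ _ (F X Y)
  have C1 := fun X Y => comm_formula h.cyc (Matrix.of fun Z W => bTensor r J R Y Z * if X = W then 1 else 0)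
    (Matrix.of fun Z W => bTensor r J R X Z * if Y = W then 1 else 0)
    (bTensor r J R Y X - bTensor r J R X Y) (e 1 X Y) (e 2 X Y) (e 0 X Y) _ ((F X Y).trans
    (by rw [hOp_cyc, hOp_cyc (N := Matrix.of fun Z W => bTensor r J R X Z * if Y = W then 1 else 0)]
        abel))
  have C2 := fun X Y => comm_formula h.cyc.cyc (Matrix.of fun Z W => bTensor r J R Y Z * if X = W then 1 else 0)
    (Matrix.of fun Z W => bTensor r J R X Z * if Y = W then 1 else 0)
    (bTensor r J R Y X - bTensor r J R X Y) (e 2 X Y) (e 0 X Y) (e 1 X Y) _ ((F X Y).trans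
    (by rw [hOp_cyc, hOp_cyc (N := Matrix.of fun Z W => bTensor r J R X Z * if Y = W then 1 else 0),
          hOp_cyc, hOp_cyc (N := Matrix.of fun Z W => bTensor r J R X Z * if Y = W then 1 else 0)]
        abel))
  obtain ⟨d, hd⟩ : ∃ d : Fin 3 → Matrix (Fin (4 * r)) (Fin (4 * r)) ℝ, ∀ α X Y,
    d α X Y = 𝓡 α X Y - e α X Y := ⟨fun α => Matrix.of fun X Y => _, fun α X Y => rfl⟩
  have ha : ∀ α X Y, d α X Y = - d α Y X := by
    intro α X Y
    rw [hd, hd, he, he, h𝓡anti]; ring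
  have E0 : ∀ X Y, Matrix.of (J 0) * D X Y - D X Y * Matrix.of (J 0)
      = (2 * d 2 X Y) • Matrix.of (J 1) - (2 * d 1 X Y) • Matrix.of (J 2) := by
    intro X Y
    have n0 := hnm 0 X Y
    simp [Fin.sum_univ_three, epsLC, -Matrix.smul_of, -Matrix.of_add_of, -Matrix.neg_of] at n0
    rw [hD, hd, hd]
    rw [mul_sub, sub_mul]
    linear_combination (norm := module) n0 - C0 X Y
  have E1 : ∀ X Y, Matrix.of (J 1) * D X Y - D X Y * Matrix.of (J 1)
      = (2 * d 0 X Y) • Matrix.of (J 2) - (2 * d 2 X Y) • Matrix.of (J 0) := by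
    intro X Y
    have n0 := hnm 1 X Y
    simp [Fin.sum_univ_three, epsLC, -Matrix.smul_of, -Matrix.of_add_of, -Matrix.neg_of] at n0
    rw [hD, hd, hd]
    rw [mul_sub, sub_mul]
    linear_combination (norm := module) n0 - C1 X Y
  have E2 : ∀ X Y, Matrix.of (J 2) * D X Y - D X Y * Matrix.of (J 2)
      = (2 * d 1 X Y) • Matrix.of (J 0) - (2 * d 0 X Y) • Matrix.of (J 1) := by
    intro X Y
    have n0 := hnm 2 X Y
    simp [Fin.sum_univ_three, epsLC, -Matrix.smul_of, -Matrix.of_add_of, -Matrix.neg_of] at n0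
    rw [hD, hd, hd]
    rw [mul_sub, sub_mul]
    linear_combination (norm := module) n0 - C2 X Y
  obtain ⟨z0, z1, z2⟩ := key h r hr' hn D (by simpa only [hDa] using B1)
    (by simpa only [hDa] using B2) (by simpa only [hDa] using B3) (d 0) (d 1) (d 2)
    (ha 0) (ha 1) (ha 2) E0 E1 E2
  have hall : ∀ α X Y, Matrix.of (J α) * D X Y - D X Y * Matrix.of (J α) = 0 := by
    intro α X Y
    fin_cases α
    · simpa [z0, z1, z2] using E0 X Y
    · simpa [z0, z1, z2] using E1 X Y
    · simpa [z0, z1, z2] using E2 X Y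
  intro α X Y Z V
  have := congrFun (congrFun (hall α X Y) Z) V
  simp only [Matrix.sub_apply, Matrix.mul_apply, Matrix.of_apply, Matrix.zero_apply, hDa] at this
  rw [← Finset.sum_sub_distrib] at this
  rw [← this]
  exact Finset.sum_congr rfl fun W _ => by ring
end
end

section
/- Let U ⊆ ℝ^n be an open star-shaped set, g a smooth field on U of invertible symmetric n×n matrices with inverse g^{αβ}, and γ_{αβ}^γ := (1/2) g^{γδ} (∂_α g_{βδ} + ∂_β g_{αδ} − ∂_δ g_{αβ}) its Levi-Civita connection coefficients. For a smooth vector field k on U set k_α := g_{αβ} k^β and 𝔇_α k_β := ∂_α k_β − γ_{αβ}^γ k_γ. Then the following two conditions are equivalent: (i) k is a homothetic Killing vector, 𝔇_α k_β + 𝔇_β k_α = (n−2) g_{αβ}, which is exact, i.e. there exists a smooth function χ : U → ℝ with k_α = ∂_α χ; (ii) k is an exact homothetic Killing vector in the sense ∂_α k^β + γ_{αγ}^β k^γ = ((n−2)/2) · δ_α^β on U. -/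
noncomputable section

/-- The Levi-Civita (Christoffel) coefficients
`γ_{ab}^c = (1/2) g^{cd} (∂_a g_{bd} + ∂_b g_{ad} − ∂_d g_{ab})` of a metric field `g`. -/
def christoffel {n : ℕ} (g : (Fin n → ℝ) → Matrix (Fin n) (Fin n) ℝ)
    (a b c : Fin n) (x : Fin n → ℝ) : ℝ :=
  (1 / 2) * ∑ d, (g x)⁻¹ c d *
    (pd a (fun y => g y b d) x + pd b (fun y => g y a d) x - pd d (fun y => g y a b) x)

/-- Lowered index vector field `k_a = g_{ab} k^b`. -/
def lowerK {n : ℕ} (g : (Fin n → ℝ) → Matrix (Fin n) (Fin n) ℝ)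
    (k : Fin n → (Fin n → ℝ) → ℝ) (a : Fin n) (x : Fin n → ℝ) : ℝ :=
  ∑ b, g x a b * k b x

/-- Covariant derivative of the lowered vector field,
`𝔇_a k_b = ∂_a k_b − γ_{ab}^c k_c`. -/
def covDLow {n : ℕ} (g : (Fin n → ℝ) → Matrix (Fin n) (Fin n) ℝ)
    (k : Fin n → (Fin n → ℝ) → ℝ) (a b : Fin n) (x : Fin n → ℝ) : ℝ :=
  pd a (lowerK g k b) x - ∑ c, christoffel g a b c x * lowerK g k c x

theorem poincare_star {n : ℕ} {U : Set (Fin n → ℝ)} (hU : IsOpen U)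
    {c₀ : Fin n → ℝ} (hstar : StarConvex ℝ c₀ U) (h : Fin n → (Fin n → ℝ) → ℝ)
    (hs : ∀ a, ContDiffOn ℝ (⊤ : ℕ∞) (h a) U)
    (hc : ∀ a b, ∀ x ∈ U, pd a (h b) x = pd b (h a) x) :
    ∃ χ : (Fin n → ℝ) → ℝ, ContDiffOn ℝ (⊤ : ℕ∞) χ U ∧ ∀ a, ∀ x ∈ U, h a x = pd a χ x := by
  set ω : (Fin n → ℝ) → (Fin n → ℝ) →L[ℝ] ℝ :=
    fun x => ∑ b, h b x • (ContinuousLinearMap.proj b : (Fin n → ℝ) →L[ℝ] ℝ) with hω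
  have hωs : ContDiffOn ℝ (⊤ : ℕ∞) ω U := by
    apply ContDiffOn.sum
    intro b _
    exact (hs b).smul contDiffOn_const
  have hd : ∀ b, ∀ x ∈ U, HasFDerivAt (h b) (fderiv ℝ (h b) x) x := fun b x hx =>
    (((hs b).contDiffAt (hU.mem_nhds hx)).differentiableAt (by simp)).hasFDerivAt
  set dω : (Fin n → ℝ) → (Fin n → ℝ) →L[ℝ] (Fin n → ℝ) →L[ℝ] ℝ :=
    fun x => ∑ b, (fderiv ℝ (h b) x).smulRight
      (ContinuousLinearMap.proj b : (Fin n → ℝ) →L[ℝ] ℝ) with hdω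
  have hωd : ∀ x ∈ U, HasFDerivAt ω (dω x) x := by
    intro x hx
    apply HasFDerivAt.fun_sum
    intro b _
    exact (hd b x hx).smul_const (ContinuousLinearMap.proj b : (Fin n → ℝ) →L[ℝ] ℝ)
  have hexp : ∀ b x (u : Fin n → ℝ), fderiv ℝ (h b) x u = ∑ a, u a * pd a (h b) x := by
    intro b x u
    have hu : u = ∑ a, u a • (Pi.single a 1 : Fin n → ℝ) := by
      funext i
      simp [Finset.sum_apply, Pi.single_apply]
    conv_lhs => rw [hu, map_sum]
    simp only [map_smul, pd, smul_eq_mul]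
  have hsym : ∀ x ∈ U, ∀ u v, dω x u v = dω x v u := by
    intro x hx u v
    simp only [hdω, ContinuousLinearMap.sum_apply, ContinuousLinearMap.smulRight_apply,
      ContinuousLinearMap.smul_apply, ContinuousLinearMap.proj_apply, smul_eq_mul, hexp,
      Finset.sum_mul]
    rw [Finset.sum_comm]
    refine Finset.sum_congr rfl fun a _ => Finset.sum_congr rfl fun b _ => ?_
    rw [hc a b x hx]; ring
  have key : ∀ b ∈ U, HasFDerivAt (fun y => curveIntegral ω (.segment c₀ y)) (ω b) b := by
    intro b hb
    obtain ⟨r, hr, hball⟩ := Metric.isOpen_iff.1 hU b hb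
    have hconv : Convex ℝ (convexJoin ℝ {c₀} (Metric.ball b r)) :=
      (convex_singleton c₀).convexJoin (convex_ball b r)
    have hsub : convexJoin ℝ {c₀} (Metric.ball b r) ⊆ U := by
      intro y hy
      simp only [mem_convexJoin, Set.mem_singleton_iff, exists_eq_left] at hy
      obtain ⟨z, hz, hy⟩ := hy
      exact hstar.segment_subset (hball hz) hy
    have hne : (Metric.ball b r).Nonempty := ⟨b, Metric.mem_ball_self hr⟩
    have hsup : Metric.ball b r ⊆ convexJoin ℝ {c₀} (Metric.ball b r) :=
      subset_convexJoin_right (Set.singleton_nonempty c₀)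
    have hc0 : c₀ ∈ convexJoin ℝ {c₀} (Metric.ball b r) :=
      subset_convexJoin_left hne rfl
    have := hconv.hasFDerivWithinAt_curveIntegral_segment_of_hasFDerivWithinAt_symmetric
      (ω := ω) (dω := dω) (a := c₀) (b := b)
      (fun x hx => (hωd x (hsub hx)).hasFDerivWithinAt)
      (fun x hx u _ v _ => hsym x (hsub hx) u v) hc0 (hsup (Metric.mem_ball_self hr))
    exact this.hasFDerivAt (Filter.mem_of_superset (Metric.ball_mem_nhds b hr) hsup)
  refine ⟨fun y => curveIntegral ω (.segment c₀ y), ?_, ?_⟩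
  · rw [contDiffOn_infty_iff_fderiv_of_isOpen hU]
    exact ⟨fun x hx => (key x hx).differentiableAt.differentiableWithinAt,
      hωs.congr fun x hx => (key x hx).fderiv⟩
  · intro a x hx
    rw [pd, (key x hx).fderiv]
    simp [hω, ContinuousLinearMap.sum_apply, Pi.single_apply]

theorem pd_symm_of_exact {n : ℕ} {U : Set (Fin n → ℝ)} (hU : IsOpen U)
    (h : Fin n → (Fin n → ℝ) → ℝ) (χ : (Fin n → ℝ) → ℝ)
    (hχ : ContDiffOn ℝ (⊤ : ℕ∞) χ U) (he : ∀ a, ∀ x ∈ U, h a x = pd a χ x)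
    (a b : Fin n) (x : Fin n → ℝ) (hx : x ∈ U) : pd a (h b) x = pd b (h a) x := by
  have hd : DifferentiableAt ℝ (fderiv ℝ χ) x :=
    ((((contDiffOn_infty_iff_fderiv_of_isOpen hU).1 hχ).2.contDiffAt
      (hU.mem_nhds hx)).differentiableAt (by simp))
  have h1 : ∀ a b, pd a (h b) x = fderiv ℝ (fderiv ℝ χ) x (Pi.single a 1) (Pi.single b 1) := by
    intro a b
    have : h b =ᶠ[nhds x] fun y => fderiv ℝ χ y (Pi.single b 1) := by
      filter_upwards [hU.mem_nhds hx] with y hy using he b y hy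
    rw [pd, this.fderiv_eq, fderiv_clm_apply hd (by fun_prop)]
    simp
  rw [h1, h1]
  exact ((hχ.contDiffAt (hU.mem_nhds hx)).isSymmSndFDerivAt (by
    rw [minSmoothness_of_isRCLikeNormedField]; exact WithTop.coe_le_coe.2 (le_top : (2 : ℕ∞) ≤ ⊤))).eq _ _

/-- Lowering an index of a Christoffel symbol. -/
theorem lower_christoffel {n : ℕ} (g : (Fin n → ℝ) → Matrix (Fin n) (Fin n) ℝ)
    (x : Fin n → ℝ) (hx : IsUnit (g x).det) (a b e : Fin n) :
    ∑ c, g x e c * christoffel g a b c x = (1 / 2) *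
      (pd a (fun y => g y b e) x + pd b (fun y => g y a e) x - pd e (fun y => g y a b) x) := by
  set w : Fin n → ℝ := fun d =>
    pd a (fun y => g y b d) x + pd b (fun y => g y a d) x - pd d (fun y => g y a b) x with hw
  have h1 : ∀ c, christoffel g a b c x = (1 / 2) * ((g x)⁻¹.mulVec w) c := fun c => rfl
  have h2 : (g x).mulVec ((g x)⁻¹.mulVec w) = w := by
    rw [Matrix.mulVec_mulVec, Matrix.mul_nonsing_inv _ hx, Matrix.one_mulVec]
  have h3 := congrFun h2 e
  calc _ = (1 / 2) * ∑ c, g x e c * ((g x)⁻¹.mulVec w) c := by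
        rw [Finset.mul_sum]
        refine Finset.sum_congr rfl fun c _ => ?_
        rw [h1]; ring
    _ = _ := by
        rw [show ∑ c, g x e c * ((g x)⁻¹.mulVec w) c = w e from h3]

theorem covDLow_eq {n : ℕ} {U : Set (Fin n → ℝ)} (hU : IsOpen U)
    (g : (Fin n → ℝ) → Matrix (Fin n) (Fin n) ℝ)
    (hgsmooth : ∀ a b, ContDiffOn ℝ (⊤ : ℕ∞) (fun y => g y a b) U)
    (hgsym : ∀ a b, ∀ x ∈ U, g x a b = g x b a)
    (hginv : ∀ x ∈ U, IsUnit (g x).det)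
    (k : Fin n → (Fin n → ℝ) → ℝ)
    (hksmooth : ∀ a, ContDiffOn ℝ (⊤ : ℕ∞) (k a) U)
    (a b : Fin n) (x : Fin n → ℝ) (hx : x ∈ U) :
    covDLow g k a b x =
      ∑ c, g x b c * (pd a (k c) x + ∑ d, christoffel g a d c x * k d x) := by
  have hg : ∀ a b, DifferentiableAt ℝ (fun y => g y a b) x := fun a b =>
    ((hgsmooth a b).contDiffAt (hU.mem_nhds hx)).differentiableAt (by simp)
  have hk : ∀ a, DifferentiableAt ℝ (k a) x := fun a =>
    ((hksmooth a).contDiffAt (hU.mem_nhds hx)).differentiableAt (by simp)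
  have hs : ∀ a b c, pd a (fun y => g y b c) x = pd a (fun y => g y c b) x := by
    intro a b c
    have : (fun y => g y b c) =ᶠ[nhds x] (fun y => g y c b) := by
      filter_upwards [hU.mem_nhds hx] with y hy using hgsym b c y hy
    rw [pd, pd, this.fderiv_eq]
  have h1 : pd a (lowerK g k b) x
      = ∑ c, (g x b c * pd a (k c) x + pd a (fun y => g y b c) x * k c x) := by
    have : HasFDerivAt (lowerK g k b) (∑ c, (g x b c • fderiv ℝ (k c) x
        + k c x • fderiv ℝ (fun y => g y b c) x)) x :=
      HasFDerivAt.fun_sum fun c _ => (hg b c).hasFDerivAt.mul (hk c).hasFDerivAt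
    rw [pd, this.fderiv]
    simp [ContinuousLinearMap.sum_apply, pd, mul_comm]
  have h2 : ∑ c, christoffel g a b c x * lowerK g k c x
      = ∑ d, (1 / 2) * (pd a (fun y => g y b d) x + pd b (fun y => g y a d) x
          - pd d (fun y => g y a b) x) * k d x := by
    simp only [lowerK, Finset.mul_sum]
    rw [Finset.sum_comm]
    refine Finset.sum_congr rfl fun d _ => ?_
    rw [← lower_christoffel g x (hginv x hx), Finset.sum_mul]
    refine Finset.sum_congr rfl fun c _ => ?_
    rw [hgsym c d x hx]; ring
  have h3 : ∑ c, g x b c * ∑ d, christoffel g a d c x * k d x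
      = ∑ d, (1 / 2) * (pd a (fun y => g y d b) x + pd d (fun y => g y a b) x
          - pd b (fun y => g y a d) x) * k d x := by
    simp only [Finset.mul_sum]
    rw [Finset.sum_comm]
    refine Finset.sum_congr rfl fun d _ => ?_
    rw [← lower_christoffel g x (hginv x hx), Finset.sum_mul]
    refine Finset.sum_congr rfl fun c _ => ?_
    ring
  simp only [mul_add, Finset.sum_add_distrib]
  rw [h3, covDLow, h1, h2, Finset.sum_add_distrib, add_sub_assoc, ← Finset.sum_sub_distrib]
  congr 1
  refine Finset.sum_congr rfl fun d _ => ?_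
  rw [hs a d b]; ring

theorem christoffel_symm {n : ℕ} {U : Set (Fin n → ℝ)} (hU : IsOpen U)
    (g : (Fin n → ℝ) → Matrix (Fin n) (Fin n) ℝ)
    (hgsym : ∀ a b, ∀ x ∈ U, g x a b = g x b a)
    (a b c : Fin n) (x : Fin n → ℝ) (hx : x ∈ U) :
    christoffel g a b c x = christoffel g b a c x := by
  have hs : ∀ d, pd d (fun y => g y a b) x = pd d (fun y => g y b a) x := by
    intro d
    have : (fun y => g y a b) =ᶠ[nhds x] (fun y => g y b a) := by
      filter_upwards [hU.mem_nhds hx] with y hy using hgsym a b y hy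
    rw [pd, pd, this.fderiv_eq]
  simp only [christoffel, hs]
  congr 1
  refine Finset.sum_congr rfl fun d _ => ?_
  ring

/-- on an open star-shaped `U ⊆ ℝ^n` with smooth invertible symmetric
metric `g` and Levi-Civita connection `γ`, a smooth vector field `k` is a homothetic
Killing vector (`𝔇_a k_b + 𝔇_b k_a = (n−2) g_{ab}`) which is exact (`k_a = ∂_a χ` for
some smooth `χ`) if and only if `∂_a k^b + γ_{ac}^b k^c = ((n−2)/2) δ_a^b` on `U`. -/
theorem stmt_17 (n : ℕ) (U : Set (Fin n → ℝ)) (hU : IsOpen U)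
    (c₀ : Fin n → ℝ) (hstar : StarConvex ℝ c₀ U)
    (g : (Fin n → ℝ) → Matrix (Fin n) (Fin n) ℝ)
    (hgsmooth : ∀ a b, ContDiffOn ℝ (⊤ : ℕ∞) (fun y => g y a b) U)
    (hgsym : ∀ a b, ∀ x ∈ U, g x a b = g x b a)
    (hginv : ∀ x ∈ U, IsUnit (g x).det)
    (k : Fin n → (Fin n → ℝ) → ℝ)
    (hksmooth : ∀ a, ContDiffOn ℝ (⊤ : ℕ∞) (k a) U) :
    (((∀ a b, ∀ x ∈ U, covDLow g k a b x + covDLow g k b a x = ((n : ℝ) - 2) * g x a b) ∧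
      ∃ χ : (Fin n → ℝ) → ℝ, ContDiffOn ℝ (⊤ : ℕ∞) χ U ∧
        ∀ a, ∀ x ∈ U, lowerK g k a x = pd a χ x)
      ↔
     (∀ a b, ∀ x ∈ U, pd a (k b) x + ∑ c, christoffel g a c b x * k c x
        = (((n : ℝ) - 2) / 2) * (if a = b then 1 else 0))) := by
  have hcov := covDLow_eq hU g hgsmooth hgsym hginv k hksmooth
  have hlow : ∀ a, ContDiffOn ℝ (⊤ : ℕ∞) (lowerK g k a) U := fun a =>
    ContDiffOn.sum fun b _ => (hgsmooth a b).mul (hksmooth b)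
  have hdiff : ∀ a b, ∀ x ∈ U, covDLow g k a b x - covDLow g k b a x
      = pd a (lowerK g k b) x - pd b (lowerK g k a) x := by
    intro a b x hx
    simp only [covDLow, christoffel_symm hU g hgsym a b _ x hx]
    ring
  constructor
  · rintro ⟨hkill, χ, hχ, he⟩ a b x hx
    have hlowcov : ∀ b, covDLow g k a b x = (((n : ℝ) - 2) / 2) * g x a b := by
      intro b
      have h1 := hdiff a b x hx
      rw [pd_symm_of_exact hU (lowerK g k) χ hχ he a b x hx] at h1
      have h2 := hkill a b x hx
      linarith
    set T : Fin n → ℝ := fun c => pd a (k c) x + ∑ d, christoffel g a d c x * k d x with hT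
    have h1 : (g x).mulVec T
        = (g x).mulVec (fun b => (((n : ℝ) - 2) / 2) * (if a = b then 1 else 0)) := by
      funext b
      have h2 : (g x).mulVec T b = covDLow g k a b x := (hcov a b x hx).symm
      rw [h2, hlowcov, hgsym a b x hx]
      simp [Matrix.mulVec, dotProduct, mul_comm]
    have h2 := congrArg ((g x)⁻¹.mulVec) h1
    rw [Matrix.mulVec_mulVec, Matrix.mulVec_mulVec, Matrix.nonsing_inv_mul _ (hginv x hx),
      Matrix.one_mulVec, Matrix.one_mulVec] at h2
    exact congrFun h2 b
  · intro h
    have hlowcov : ∀ a b, ∀ x ∈ U, covDLow g k a b x = (((n : ℝ) - 2) / 2) * g x a b := by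
      intro a b x hx
      rw [hcov a b x hx, hgsym a b x hx]
      simp only [h a _ x hx]
      simp [mul_comm]
    refine ⟨fun a b x hx => ?_, poincare_star hU hstar _ hlow fun a b x hx => ?_⟩
    · rw [hlowcov a b x hx, hlowcov b a x hx, hgsym b a x hx]; ring
    · have h1 := hdiff a b x hx
      rw [hlowcov a b x hx, hlowcov b a x hx, hgsym b a x hx] at h1
      linarith
end
end
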